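/- Let d = 2 and define ω : ℝ² → ℝ by ω(ξ) = √(1 + Σ_{j=1}^{2} 2(1 − cos ξ_j)). For t ∈ ℝ and x ∈ ℤ², let I(t,x) = ∫_{[0,2π]²} e^{i(x·ξ − t ω(ξ))} a(ξ) dξ, where the amplitude is a(ξ) = 1 or a(ξ) = 1/ω(ξ). Then there exists a constant C > 0, independent of t, such that sup_{x ∈ ℤ²} |I(t,x)| ≤ C(1 + |t|)^{-3/4} for all t ∈ ℝ. -/

import Mathlib

open MeasureTheory Real
open scoped ENNReal

noncomputable section

/-- Dispersion relation of the discrete Klein--Gordon equation on `ℤ^d`. -/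
def omegaKG (d : ℕ) (ξ : Fin d → ℝ) : ℝ :=
  Real.sqrt (1 + ∑ j : Fin d, 2 * (1 - Real.cos (ξ j)))

/-- The fundamental domain `[0, 2π]^d` of the torus. -/
def cube (d : ℕ) : Set (Fin d → ℝ) := Set.Icc 0 (fun _ => 2 * Real.pi)

/-- The oscillatory integral `I(t,x) = ∫_{[0,2π]^d} e^{i(x·ξ − t ω(ξ))} a(ξ) dξ`. -/
def oscInt (d : ℕ) (a : (Fin d → ℝ) → ℂ) (t : ℝ) (x : Fin d → ℤ) : ℂ :=
  ∫ ξ in cube d,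
    Complex.exp (Complex.I * (((∑ j : Fin d, (x j : ℝ) * ξ j) - t * omegaKG d ξ : ℝ) : ℂ)) * a ξ

open scoped ContDiff

theorem hasDerivAt_iteratedDeriv {φ : ℝ → ℝ} (hφ : ContDiff ℝ ∞ φ) (k : ℕ) (y : ℝ) :
    HasDerivAt (iteratedDeriv k φ) (iteratedDeriv (k + 1) φ y) y := by
  rw [iteratedDeriv_succ]
  exact (hφ.differentiable_iteratedDeriv k (by exact_mod_cast WithTop.coe_lt_top _) y).hasDerivAt

theorem continuous_iteratedDeriv_of_smooth {φ : ℝ → ℝ} (hφ : ContDiff ℝ ∞ φ) (k : ℕ) :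
    Continuous (iteratedDeriv k φ) :=
  continuous_iff_continuousAt.2 fun y => (hasDerivAt_iteratedDeriv hφ k y).continuousAt

theorem hasDerivAt_cexp_phase {φ : ℝ → ℝ} {φ' y : ℝ} (h : HasDerivAt φ φ' y) :
    HasDerivAt (fun y => Complex.exp (Complex.I * (φ y : ℂ)))
      (Complex.exp (Complex.I * (φ y : ℂ)) * (Complex.I * (φ' : ℂ))) y :=
  ((h.ofReal_comp).const_mul Complex.I).cexp

theorem norm_cexp_phase (r : ℝ) : ‖Complex.exp (Complex.I * (r : ℂ))‖ = 1 := by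
  rw [mul_comm]; exact Complex.norm_exp_ofReal_mul_I r

/-- van der Corput's estimate for a phase with monotone first derivative. -/
theorem norm_integral_phase_le_of_deriv {φ : ℝ → ℝ} (hφ : ContDiff ℝ ∞ φ) {a b l : ℝ}
    (hab : a ≤ b) (hl : 0 < l)
    (h2 : (∀ y ∈ Set.Icc a b, 0 ≤ iteratedDeriv 2 φ y) ∨
      (∀ y ∈ Set.Icc a b, iteratedDeriv 2 φ y ≤ 0))
    (h1 : ∀ y ∈ Set.Icc a b, l ≤ |iteratedDeriv 1 φ y|) :
    ‖∫ y in a..b, Complex.exp (Complex.I * (φ y : ℂ))‖ ≤ 4 / l := by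
  set d1 := iteratedDeriv 1 φ with hd1
  set d2 := iteratedDeriv 2 φ with hd2
  have c1 : Continuous d1 := continuous_iteratedDeriv_of_smooth hφ 1
  have c2 : Continuous d2 := continuous_iteratedDeriv_of_smooth hφ 2
  have H0 : ∀ y, HasDerivAt φ (d1 y) y := fun y => by
    have := hasDerivAt_iteratedDeriv hφ 0 y
    rwa [iteratedDeriv_zero] at this
  have H1 : ∀ y, HasDerivAt d1 (d2 y) y := fun y => hasDerivAt_iteratedDeriv hφ 1 y
  have hne : ∀ y ∈ Set.Icc a b, d1 y ≠ 0 := fun y hy h => by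
    have := h1 y hy
    rw [h] at this; simp at this; linarith
  have hu : Set.uIcc a b = Set.Icc a b := Set.uIcc_of_le hab
  have hinv : ∀ y ∈ Set.Icc a b, HasDerivAt (fun y => (d1 y)⁻¹) (-d2 y / (d1 y) ^ 2) y :=
    fun y hy => (H1 y).inv (hne y hy)
  have hcq : ContinuousOn (fun y => -d2 y / (d1 y) ^ 2) (Set.Icc a b) :=
    (c2.neg.continuousOn).div (c1.pow 2).continuousOn fun y hy => pow_ne_zero 2 (hne y hy)
  have hq : IntervalIntegrable (fun y => -d2 y / (d1 y) ^ 2) volume a b :=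
    (hu.symm ▸ hcq : ContinuousOn _ (Set.uIcc a b)).intervalIntegrable
  have hftc : ∫ y in a..b, -d2 y / (d1 y) ^ 2 = (d1 b)⁻¹ - (d1 a)⁻¹ :=
    intervalIntegral.integral_eq_sub_of_hasDerivAt (fun y hy => hinv y (hu ▸ hy)) hq
  have hb : ∀ y ∈ Set.Icc a b, |(d1 y)⁻¹| ≤ 1 / l := fun y hy => by
    rw [abs_inv, ← one_div]; exact one_div_le_one_div_of_le hl (h1 y hy)
  have hae : a ∈ Set.Icc a b := ⟨le_rfl, hab⟩
  have hbe : b ∈ Set.Icc a b := ⟨hab, le_rfl⟩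
  have htv : ∫ y in a..b, |-d2 y / (d1 y) ^ 2| ≤ 2 / l := by
    have key : ∫ y in a..b, |-d2 y / (d1 y) ^ 2| = |∫ y in a..b, -d2 y / (d1 y) ^ 2| := by
      rcases h2 with h2 | h2
      · have e : ∫ y in a..b, |-d2 y / (d1 y) ^ 2| = - ∫ y in a..b, -d2 y / (d1 y) ^ 2 := by
          rw [← intervalIntegral.integral_neg]
          refine intervalIntegral.integral_congr fun y hy => ?_
          refine abs_of_nonpos (div_nonpos_of_nonpos_of_nonneg ?_ (sq_nonneg _))
          linarith [h2 y (hu ▸ hy)]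
        have : 0 ≤ ∫ y in a..b, |-d2 y / (d1 y) ^ 2| :=
          intervalIntegral.integral_nonneg hab fun _ _ => abs_nonneg _
        rw [e, abs_of_nonpos]; linarith
      · have e : ∫ y in a..b, |-d2 y / (d1 y) ^ 2| = ∫ y in a..b, -d2 y / (d1 y) ^ 2 := by
          refine intervalIntegral.integral_congr fun y hy => ?_
          refine abs_of_nonneg (div_nonneg ?_ (sq_nonneg _))
          linarith [h2 y (hu ▸ hy)]
        have : 0 ≤ ∫ y in a..b, |-d2 y / (d1 y) ^ 2| :=
          intervalIntegral.integral_nonneg hab fun _ _ => abs_nonneg _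
        rw [e] at this ⊢; rw [abs_of_nonneg this]
    rw [key, hftc]
    calc _ ≤ |(d1 b)⁻¹| + |(d1 a)⁻¹| := abs_sub _ _
      _ ≤ 1 / l + 1 / l := add_le_add (hb b hbe) (hb a hae)
      _ = 2 / l := by ring
  set e : ℝ → ℂ := fun y => Complex.exp (Complex.I * (φ y : ℂ)) with he
  have ce : Continuous e := by
    have := hφ.continuous
    fun_prop
  have hibp := intervalIntegral.integral_mul_deriv_eq_deriv_mul (a := a) (b := b)
    (u := fun y => (((d1 y)⁻¹ : ℝ) : ℂ)) (u' := fun y => ((-d2 y / (d1 y) ^ 2 : ℝ) : ℂ))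
    (v := e) (v' := fun y => e y * (Complex.I * (d1 y : ℂ)))
    (fun y hy => (hinv y (hu ▸ hy)).ofReal_comp) (fun y _ => hasDerivAt_cexp_phase (H0 y))
    ⟨hq.1.ofReal, hq.2.ofReal⟩ (by apply Continuous.intervalIntegrable; fun_prop)
  have hint : ∫ y in a..b, (((d1 y)⁻¹ : ℝ) : ℂ) * (e y * (Complex.I * (d1 y : ℂ)))
      = Complex.I * ∫ y in a..b, e y := by
    rw [← intervalIntegral.integral_const_mul]
    refine intervalIntegral.integral_congr fun y hy => ?_
    have : (d1 y : ℂ) ≠ 0 := by exact_mod_cast hne y (hu ▸ hy)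
    simp only [Complex.ofReal_inv]
    field_simp
  have hn : ‖∫ y in a..b, e y‖ = ‖Complex.I * ∫ y in a..b, e y‖ := by simp
  have ne : ∀ y, ‖e y‖ = 1 := fun y => norm_cexp_phase _
  have nb : ∀ y ∈ Set.Icc a b, ‖(((d1 y)⁻¹ : ℝ) : ℂ) * e y‖ ≤ 1 / l := fun y hy => by
    rw [norm_mul, ne, mul_one, Complex.norm_real, Real.norm_eq_abs]; exact hb y hy
  rw [hn, ← hint, hibp]
  have n3 : ‖∫ y in a..b, ((-d2 y / (d1 y) ^ 2 : ℝ) : ℂ) * e y‖ ≤ 2 / l := by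
    refine (intervalIntegral.norm_integral_le_integral_norm hab).trans (le_of_eq_of_le ?_ htv)
    refine intervalIntegral.integral_congr fun y _ => ?_
    simp only [norm_mul, ne, mul_one, Complex.norm_real, Real.norm_eq_abs]
  calc _ ≤ 1 / l + 1 / l + 2 / l := (norm_sub_le _ _).trans
        (add_le_add ((norm_sub_le _ _).trans (add_le_add (nb b hbe) (nb a hae))) n3)
    _ = 4 / l := by ring

theorem abs_ge_cases {ψ : ℝ → ℝ} (hψ : Continuous ψ) {a b l : ℝ} (hl : 0 < l)
    (h : ∀ y ∈ Set.Icc a b, l ≤ |ψ y|) :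
    (∀ y ∈ Set.Icc a b, l ≤ ψ y) ∨ (∀ y ∈ Set.Icc a b, ψ y ≤ -l) := by
  by_contra! hc
  obtain ⟨⟨y, hy, hy'⟩, ⟨z, hz, hz'⟩⟩ := hc
  have h1 : ψ y < 0 := by
    rcases le_abs.1 (h y hy) with h | h <;> linarith
  have h2 : 0 < ψ z := by
    rcases le_abs.1 (h z hz) with h | h <;> linarith
  obtain ⟨c, hc, hc0⟩ := isPreconnected_Icc.intermediate_value hy hz hψ.continuousOn
    (⟨h1.le, h2.le⟩ : (0 : ℝ) ∈ Set.Icc _ _)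
  have := h c hc
  rw [hc0, abs_zero] at this
  linarith

theorem exists_mul_abs_sub_le_of_deriv_ge {ψ ψ' : ℝ → ℝ} (hψ : ∀ y, HasDerivAt ψ (ψ' y) y)
    {a b l : ℝ} (hab : a ≤ b) (h : ∀ y ∈ Set.Icc a b, l ≤ ψ' y) :
    ∃ c ∈ Set.Icc a b, ∀ y ∈ Set.Icc a b, l * |y - c| ≤ |ψ y| := by
  have hd : Differentiable ℝ ψ := fun y => (hψ y).differentiableAt
  have mono : ∀ x ∈ Set.Icc a b, ∀ y ∈ Set.Icc a b, x ≤ y → l * (y - x) ≤ ψ y - ψ x := by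
    refine (convex_Icc a b).mul_sub_le_image_sub_of_le_deriv hd.continuous.continuousOn
      hd.differentiableOn fun y hy => ?_
    rw [(hψ y).deriv]; exact h y (interior_subset hy)
  have hae : a ∈ Set.Icc a b := ⟨le_rfl, hab⟩
  have hbe : b ∈ Set.Icc a b := ⟨hab, le_rfl⟩
  by_cases h0 : 0 ≤ ψ a
  · refine ⟨a, hae, fun y hy => ?_⟩
    have := mono a hae y hy hy.1
    rw [abs_of_nonneg (sub_nonneg.2 hy.1)]
    exact le_abs.2 (Or.inl (by linarith))
  by_cases h1 : ψ b ≤ 0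
  · refine ⟨b, hbe, fun y hy => ?_⟩
    have := mono y hy b hbe hy.2
    rw [abs_of_nonpos (sub_nonpos.2 hy.2)]
    exact le_abs.2 (Or.inr (by linarith))
  push Not at h0 h1
  obtain ⟨c, hc, hc0⟩ := intermediate_value_Icc hab hd.continuous.continuousOn
    (⟨h0.le, h1.le⟩ : (0 : ℝ) ∈ Set.Icc _ _)
  refine ⟨c, hc, fun y hy => ?_⟩
  rcases le_total c y with hcy | hcy
  · have := mono c hc y hy hcy
    rw [abs_of_nonneg (sub_nonneg.2 hcy)]
    exact le_abs.2 (Or.inl (by linarith))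
  · have := mono y hy c hc hcy
    rw [abs_of_nonpos (sub_nonpos.2 hcy)]
    exact le_abs.2 (Or.inr (by linarith))

theorem exists_mul_abs_sub_le {ψ ψ' : ℝ → ℝ} (hψ : ∀ y, HasDerivAt ψ (ψ' y) y)
    (hc : Continuous ψ') {a b l : ℝ} (hab : a ≤ b) (hl : 0 < l)
    (h : ∀ y ∈ Set.Icc a b, l ≤ |ψ' y|) :
    ∃ c ∈ Set.Icc a b, ∀ y ∈ Set.Icc a b, l * |y - c| ≤ |ψ y| := by
  rcases abs_ge_cases hc hl h with h | h
  · exact exists_mul_abs_sub_le_of_deriv_ge hψ hab h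
  · obtain ⟨c, hc, H⟩ := exists_mul_abs_sub_le_of_deriv_ge (ψ := fun y => -ψ y)
      (ψ' := fun y => -ψ' y) (fun y => (hψ y).neg) hab
      (fun y hy => by linarith [h y hy])
    exact ⟨c, hc, fun y hy => by simpa using H y hy⟩

theorem norm_integral_le_of_away {e : ℝ → ℂ} (he : Continuous e) (hn : ∀ y, ‖e y‖ ≤ 1)
    {a b c δ K : ℝ} (hc : c ∈ Set.Icc a b) (hδ : 0 < δ) (hK : 0 ≤ K)
    (h : ∀ a' b', a ≤ a' → a' ≤ b' → b' ≤ b → (∀ y ∈ Set.Icc a' b', δ ≤ |y - c|) →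
      ‖∫ y in a'..b', e y‖ ≤ K) :
    ‖∫ y in a..b, e y‖ ≤ 2 * K + 2 * δ := by
  set α := max a (c - δ)
  set β := min b (c + δ)
  have i : ∀ x y, IntervalIntegrable e volume x y := fun x y => he.intervalIntegrable x y
  have haα : a ≤ α := le_max_left _ _
  have hαc : α ≤ c := max_le hc.1 (by linarith)
  have hcβ : c ≤ β := le_min hc.2 (by linarith)
  have hβb : β ≤ b := min_le_left _ _
  have l1 : ‖∫ y in a..α, e y‖ ≤ K := by
    rcases le_total (c - δ) a with h' | h'
    · have : α = a := max_eq_left h'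
      rw [this]; simpa using hK
    · refine h a α le_rfl haα (by linarith) fun y hy => ?_
      have : α = c - δ := max_eq_right h'
      rw [this] at hy
      exact le_abs.2 (Or.inr (by linarith [hy.2]))
  have l3 : ‖∫ y in β..b, e y‖ ≤ K := by
    rcases le_total b (c + δ) with h' | h'
    · have : β = b := min_eq_left h'
      rw [this]; simpa using hK
    · refine h β b (by linarith) hβb le_rfl fun y hy => ?_
      have : β = c + δ := min_eq_right h'
      rw [this] at hy
      exact le_abs.2 (Or.inl (by linarith [hy.1]))
  have l2 : ‖∫ y in α..β, e y‖ ≤ 2 * δ := by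
    refine (intervalIntegral.norm_integral_le_of_norm_le_const fun y _ => hn y).trans ?_
    rw [one_mul, abs_of_nonneg (by linarith)]
    have : c - δ ≤ α := le_max_right _ _
    have : β ≤ c + δ := min_le_right _ _
    linarith
  rw [← intervalIntegral.integral_add_adjacent_intervals (i a β) (i β b),
    ← intervalIntegral.integral_add_adjacent_intervals (i a α) (i α β)]
  calc _ ≤ K + 2 * δ + K := (norm_add_le _ _).trans
        (add_le_add ((norm_add_le _ _).trans (add_le_add l1 l2)) l3)
    _ = _ := by ring

theorem norm_integral_phase_le_of_iteratedDeriv_two {φ : ℝ → ℝ} (hφ : ContDiff ℝ ∞ φ)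
    {a b l : ℝ} (hab : a ≤ b) (hl : 0 < l)
    (h : ∀ y ∈ Set.Icc a b, l ≤ |iteratedDeriv 2 φ y|) :
    ‖∫ y in a..b, Complex.exp (Complex.I * (φ y : ℂ))‖ ≤ 10 * l ^ (-(1 : ℝ) / 2) := by
  obtain ⟨c, hc, H⟩ := exists_mul_abs_sub_le (hasDerivAt_iteratedDeriv hφ 1)
    (continuous_iteratedDeriv_of_smooth hφ 2) hab hl h
  set δ := l ^ (-(1 : ℝ) / 2) with hδ
  have hδ0 : 0 < δ := rpow_pos_of_pos hl _
  have hlδ : l * δ * δ = 1 := by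
    rw [mul_assoc, ← rpow_add hl]; norm_num
    rw [rpow_neg_one]; field_simp
  have hc' := hφ.continuous
  have := norm_integral_le_of_away (e := fun y => Complex.exp (Complex.I * (φ y : ℂ)))
    (by fun_prop) (fun y => (norm_cexp_phase _).le) hc hδ0
    (K := 4 / (l * δ)) (by positivity) (fun a' b' ha' hab' hb' hy => by
      have hsub : Set.Icc a' b' ⊆ Set.Icc a b := Set.Icc_subset_Icc ha' hb'
      refine norm_integral_phase_le_of_deriv hφ hab' (by positivity) ?_ fun y hy' =>
        (mul_le_mul_of_nonneg_left (hy y hy') hl.le).trans (H y (hsub hy'))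
      rcases abs_ge_cases (continuous_iteratedDeriv_of_smooth hφ 2) hl h with h | h
      · exact Or.inl fun y hy => hl.le.trans (h y (hsub hy))
      · exact Or.inr fun y hy => (h y (hsub hy)).trans (by linarith))
  have e : 4 / (l * δ) = 4 * δ := by
    rw [div_eq_iff (by positivity)]; linear_combination (-4 : ℝ) * hlδ
  rw [e] at this
  linarith

/-- van der Corput's estimate of order `k`. -/
theorem exists_norm_integral_phase_le {k : ℕ} (hk : 2 ≤ k) :
    ∃ C : ℝ, 0 < C ∧ ∀ (φ : ℝ → ℝ), ContDiff ℝ ∞ φ → ∀ (a b l : ℝ), a ≤ b → 0 < l →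
      (∀ y ∈ Set.Icc a b, l ≤ |iteratedDeriv k φ y|) →
      ‖∫ y in a..b, Complex.exp (Complex.I * (φ y : ℂ))‖ ≤ C * l ^ (-(1 : ℝ) / k) := by
  induction k, hk using Nat.le_induction with
  | base =>
    exact ⟨10, by norm_num, fun φ hφ a b l hab hl h => by
      simpa using norm_integral_phase_le_of_iteratedDeriv_two hφ hab hl h⟩
  | succ k hk ih =>
    obtain ⟨C, hC, ih⟩ := ih
    refine ⟨2 * C + 2, by positivity, fun φ hφ a b l hab hl h => ?_⟩
    obtain ⟨c, hc, H⟩ := exists_mul_abs_sub_le (hasDerivAt_iteratedDeriv hφ k)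
      (continuous_iteratedDeriv_of_smooth hφ (k + 1)) hab hl h
    set δ := l ^ (-(1 : ℝ) / (k + 1 : ℕ)) with hδ
    have hδ0 : 0 < δ := rpow_pos_of_pos hl _
    have hk0 : (0 : ℝ) < k := by exact_mod_cast (by omega : 0 < k)
    have hlδ : (l * δ) ^ (-(1 : ℝ) / k) = δ := by
      have : l * δ = l ^ ((k : ℝ) / (k + 1 : ℕ)) := by
        rw [hδ]; nth_rewrite 1 [← rpow_one l]; rw [← rpow_add hl]
        congr 1; push_cast; field_simp; ring
      rw [this, ← rpow_mul hl.le, hδ]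
      congr 1; push_cast; field_simp
    have hc' := hφ.continuous
    have := norm_integral_le_of_away (e := fun y => Complex.exp (Complex.I * (φ y : ℂ)))
      (by fun_prop) (fun y => (norm_cexp_phase _).le) hc hδ0
      (K := C * (l * δ) ^ (-(1 : ℝ) / k)) (by positivity) (fun a' b' ha' hab' hb' hy =>
        ih φ hφ a' b' (l * δ) hab' (by positivity) fun y hy' =>
          (mul_le_mul_of_nonneg_left (hy y hy') hl.le).trans
            (H y (Set.Icc_subset_Icc ha' hb' hy')))
    rw [hlδ] at this
    linarith

/-- van der Corput's estimate with an amplitude vanishing at the right endpoint. -/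
theorem norm_integral_phase_mul_le {φ γ γ' : ℝ → ℝ} (hφ : ContDiff ℝ ∞ φ)
    {a b K M : ℝ} (hab : a ≤ b) (hγ : ∀ y, HasDerivAt γ (γ' y) y) (hγ' : Continuous γ')
    (hb : γ b = 0) (hM : ∀ y, |γ' y| ≤ M) (hK : 0 ≤ K)
    (h : ∀ y ∈ Set.Icc a b, ‖∫ s in a..y, Complex.exp (Complex.I * (φ s : ℂ))‖ ≤ K) :
    ‖∫ y in a..b, Complex.exp (Complex.I * (φ y : ℂ)) * (γ y : ℂ)‖ ≤ K * M * (b - a) := by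
  have hc' := hφ.continuous
  have ce : Continuous fun s => Complex.exp (Complex.I * (φ s : ℂ)) := by fun_prop
  have hibp := intervalIntegral.integral_mul_deriv_eq_deriv_mul (a := a) (b := b)
    (u := fun y => (γ y : ℂ)) (u' := fun y => (γ' y : ℂ))
    (v := fun y => ∫ s in a..y, Complex.exp (Complex.I * (φ s : ℂ)))
    (v' := fun s => Complex.exp (Complex.I * (φ s : ℂ)))
    (fun y _ => (hγ y).ofReal_comp) (fun y _ => (ce.integral_hasStrictDerivAt a y).hasDerivAt)
    (by apply Continuous.intervalIntegrable; fun_prop) (ce.intervalIntegrable _ _)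
  simp only [hb, Complex.ofReal_zero, zero_mul, intervalIntegral.integral_same, mul_zero,
    sub_zero, zero_sub] at hibp
  simp only [mul_comm (Complex.exp _)]
  rw [hibp, norm_neg]
  refine (intervalIntegral.norm_integral_le_of_norm_le_const (C := K * M) fun y hy => ?_).trans
    (by rw [abs_of_nonneg (by linarith)])
  rw [Set.uIoc_of_le hab] at hy
  rw [norm_mul, Complex.norm_real, Real.norm_eq_abs, mul_comm]
  exact mul_le_mul (h y ⟨hy.1.le, hy.2⟩) (hM y) (abs_nonneg _) hK

/-- Partial derivative in the first variable. -/
def pd1 (F : ℝ × ℝ → ℝ) (z : ℝ × ℝ) : ℝ := fderiv ℝ F z (1, 0)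

/-- Partial derivative in the second variable. -/
def pd2 (F : ℝ × ℝ → ℝ) (z : ℝ × ℝ) : ℝ := fderiv ℝ F z (0, 1)

theorem ContDiff.pd1 {F : ℝ × ℝ → ℝ} (hF : ContDiff ℝ ∞ F) : ContDiff ℝ ∞ (pd1 F) :=
  (hF.fderiv_right (m := ∞) (by simp)).clm_apply contDiff_const

theorem ContDiff.pd2 {F : ℝ × ℝ → ℝ} (hF : ContDiff ℝ ∞ F) : ContDiff ℝ ∞ (pd2 F) :=
  (hF.fderiv_right (m := ∞) (by simp)).clm_apply contDiff_const

theorem hasDerivAt_pd1 {F : ℝ × ℝ → ℝ} {x y : ℝ} (hF : DifferentiableAt ℝ F (x, y)) :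
    HasDerivAt (fun x => F (x, y)) (pd1 F (x, y)) x := by
  have h1 : HasDerivAt (fun x : ℝ => (x, y)) ((1 : ℝ), (0 : ℝ)) x :=
    (hasDerivAt_id x).prodMk (hasDerivAt_const x y)
  exact hF.hasFDerivAt.comp_hasDerivAt x h1

theorem hasDerivAt_pd2 {F : ℝ × ℝ → ℝ} {x y : ℝ} (hF : DifferentiableAt ℝ F (x, y)) :
    HasDerivAt (fun y => F (x, y)) (pd2 F (x, y)) y := by
  have h1 : HasDerivAt (fun y : ℝ => (x, y)) ((0 : ℝ), (1 : ℝ)) y :=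
    (hasDerivAt_const y x).prodMk (hasDerivAt_id y)
  exact hF.hasFDerivAt.comp_hasDerivAt y h1

theorem ContDiff.differentiableAt_infty {E : Type*} [NormedAddCommGroup E] [NormedSpace ℝ E]
    {F : E → ℝ} (hF : ContDiff ℝ ∞ F) (z : E) : DifferentiableAt ℝ F z :=
  hF.differentiable (by simp) z

theorem tsupport_pd1_subset (F : ℝ × ℝ → ℝ) : tsupport (pd1 F) ⊆ tsupport F :=
  tsupport_fderiv_apply_subset ℝ _

/-- The phase in coordinates where the critical set is the line `z.1 = v₁`. -/
def modelPhase (L X : ℝ × ℝ → ℝ) (t v₁ v₂ : ℝ) (z : ℝ × ℝ) : ℝ :=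
  t * (v₂ * z.2 + L z - (z.1 - v₁) * X z)

theorem contDiff_modelPhase {L X : ℝ × ℝ → ℝ} (hL : ContDiff ℝ ∞ L) (hX : ContDiff ℝ ∞ X)
    (t v₁ v₂ : ℝ) : ContDiff ℝ ∞ (modelPhase L X t v₁ v₂) := by
  unfold modelPhase
  fun_prop

theorem iteratedDeriv_modelPhase {L X : ℝ × ℝ → ℝ} (hL : ContDiff ℝ ∞ L) (hX : ContDiff ℝ ∞ X)
    (t v₁ v₂ p y : ℝ) {k : ℕ} (hk : 2 ≤ k) :
    iteratedDeriv k (fun y => modelPhase L X t v₁ v₂ (p, y)) y =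
      t * (iteratedDeriv k (fun y => L (p, y)) y - (p - v₁) * iteratedDeriv k (fun y => X (p, y)) y)
    := by
  have h1 : ContDiff ℝ ∞ fun y => L (p, y) := by fun_prop
  have h2 : ContDiff ℝ ∞ fun y => X (p, y) := by fun_prop
  have c1 := (contDiff_infty.1 h1 k).contDiffAt (x := y)
  have c2 := (contDiff_infty.1 h2 k).contDiffAt (x := y)
  have h3 : iteratedDeriv k (fun y : ℝ => v₂ * y) y = 0 := by
    obtain ⟨j, rfl⟩ : ∃ j, k = j + 2 := ⟨k - 2, by omega⟩
    rw [iteratedDeriv_succ', iteratedDeriv_succ']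
    have e1 : deriv (fun y : ℝ => v₂ * y) = fun _ => v₂ := by ext; simp
    rw [e1]
    simp
  unfold modelPhase
  simp only
  rw [iteratedDeriv_const_mul_field]
  have e : (fun y => v₂ * y + L (p, y) - (p - v₁) * X (p, y)) =
      ((fun y => v₂ * y) + fun y => L (p, y)) - fun y => (p - v₁) * X (p, y) := rfl
  have c3 : ContDiffAt ℝ k (fun y : ℝ => v₂ * y) y := by fun_prop
  have c4 : ContDiffAt ℝ k (fun y : ℝ => (p - v₁) * X (p, y)) y := contDiffAt_const.mul c2
  have c5 : ContDiffAt ℝ k ((fun y : ℝ => v₂ * y) + fun y => L (p, y)) y := c3.add c1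
  rw [e, iteratedDeriv_sub c5 c4, iteratedDeriv_add c3 c1, h3, iteratedDeriv_const_mul_field]
  ring

/-- Uniform decay in the second variable, near the critical line. -/
theorem exists_inner_bound {L X γ : ℝ × ℝ → ℝ} (hL : ContDiff ℝ ∞ L) (hX : ContDiff ℝ ∞ X)
    (hγ : ContDiff ℝ ∞ γ) {a₁ b₁ a₂ b₂ : ℝ} (h₂ : a₂ < b₂)
    (hs : tsupport γ ⊆ Set.Ioo a₁ b₁ ×ˢ Set.Ioo a₂ b₂)
    {k : ℕ} (hk : 2 ≤ k) (hk4 : k ≤ 4) {c c₀ : ℝ} (hc : 0 < c)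
    (hLX : ∀ p ∈ Set.Icc a₁ b₁, ∀ y ∈ Set.Icc a₂ b₂, ∀ v₁, |p - v₁| ≤ c₀ →
      c ≤ |iteratedDeriv k (fun y => L (p, y)) y
        - (p - v₁) * iteratedDeriv k (fun y => X (p, y)) y|) :
    ∃ C : ℝ, 0 < C ∧ ∀ t v₁ v₂ p : ℝ, 1 ≤ t →
      ‖∫ y, Complex.exp (Complex.I * (modelPhase L X t v₁ v₂ (p, y) : ℂ)) * (γ (p, y) : ℂ)‖ ≤ C ∧
      (|p - v₁| ≤ c₀ →
        ‖∫ y, Complex.exp (Complex.I * (modelPhase L X t v₁ v₂ (p, y) : ℂ)) * (γ (p, y) : ℂ)‖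
          ≤ C * t ^ (-(1 : ℝ) / 4)) := by
  obtain ⟨A, hA, hvdc⟩ := exists_norm_integral_phase_le hk
  have hcs : HasCompactSupport γ := by
    refine HasCompactSupport.of_support_subset_isCompact
      ((isCompact_Icc (a := a₁) (b := b₁)).prod (isCompact_Icc (a := a₂) (b := b₂)))
      ((subset_tsupport γ).trans (hs.trans ?_))
    exact Set.prod_mono Set.Ioo_subset_Icc_self Set.Ioo_subset_Icc_self
  have hcs' : HasCompactSupport (pd2 γ) := by
    have := (hcs.fderiv (𝕜 := ℝ))
    exact this.comp_left (g := fun l : ℝ × ℝ →L[ℝ] ℝ => l (0, 1)) rfl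
  obtain ⟨M0, hM0⟩ := hcs.exists_bound_of_continuous hγ.continuous
  obtain ⟨M1, hM1⟩ := hcs'.exists_bound_of_continuous hγ.pd2.continuous
  have hM0' : 0 ≤ M0 := (norm_nonneg _).trans (hM0 (0, 0))
  have hM1' : 0 ≤ M1 := (norm_nonneg _).trans (hM1 (0, 0))
  have hzero : ∀ p y, ¬ (p ∈ Set.Ioo a₁ b₁ ∧ y ∈ Set.Ioo a₂ b₂) → γ (p, y) = 0 :=
    fun p y h => image_eq_zero_of_notMem_tsupport fun h' => h (hs h')
  have hba : 0 < b₂ - a₂ := by linarith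
  refine ⟨(M0 + A * c ^ (-(1 : ℝ) / k) * M1) * (b₂ - a₂) + 1, by positivity, ?_⟩
  intro t v₁ v₂ p ht
  set φ : ℝ → ℝ := fun y => modelPhase L X t v₁ v₂ (p, y) with hφdef
  have hφ : ContDiff ℝ ∞ φ := by
    have := contDiff_modelPhase hL hX t v₁ v₂
    fun_prop
  have hint : ∫ y, Complex.exp (Complex.I * (φ y : ℂ)) * (γ (p, y) : ℂ) =
      ∫ y in a₂..b₂, Complex.exp (Complex.I * (φ y : ℂ)) * (γ (p, y) : ℂ) := by
    rw [intervalIntegral.integral_of_le h₂.le, setIntegral_eq_integral_of_forall_compl_eq_zero]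
    intro y hy
    rw [hzero p y fun h => hy (Set.Ioo_subset_Ioc_self h.2)]
    simp
  have ht0 : 0 < t := by linarith
  have htp : (0 : ℝ) < t ^ (-(1 : ℝ) / 4) := rpow_pos_of_pos ht0 _
  have hAc : 0 ≤ A * c ^ (-(1 : ℝ) / k) * M1 := by positivity
  change ‖∫ y, Complex.exp (Complex.I * (φ y : ℂ)) * (γ (p, y) : ℂ)‖ ≤ _ ∧ (_ →
    ‖∫ y, Complex.exp (Complex.I * (φ y : ℂ)) * (γ (p, y) : ℂ)‖ ≤ _)
  rw [hint]
  constructor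
  · refine (intervalIntegral.norm_integral_le_of_norm_le_const (C := M0) fun y _ => ?_).trans ?_
    · rw [norm_mul, norm_cexp_phase, one_mul, Complex.norm_real]; exact hM0 _
    · rw [abs_of_pos hba]; nlinarith
  · intro hw
    by_cases hp : p ∈ Set.Icc a₁ b₁
    · have hKt : (t * c) ^ (-(1 : ℝ) / k) ≤ t ^ (-(1 : ℝ) / 4) * c ^ (-(1 : ℝ) / k) := by
        rw [mul_rpow ht0.le hc.le]
        refine mul_le_mul_of_nonneg_right (rpow_le_rpow_of_exponent_le ht ?_) (by positivity)
        have h0 : (0 : ℝ) < k := by exact_mod_cast (by omega : 0 < k)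
        have h4 : (k : ℝ) ≤ 4 := by exact_mod_cast hk4
        rw [div_le_div_iff₀ h0 (by norm_num)]; linarith
      refine (norm_integral_phase_mul_le (γ := fun y => γ (p, y)) (γ' := fun y => pd2 γ (p, y))
        (K := A * (t * c) ^ (-(1 : ℝ) / k)) (M := M1) hφ h₂.le
        (fun y => hasDerivAt_pd2 (hγ.differentiableAt_infty _))
        (hγ.pd2.continuous.comp (by fun_prop)) (hzero _ _ fun h => lt_irrefl _ h.2.2)
        (fun y => hM1 _) (by positivity) fun y hy => ?_).trans ?_
      · refine hvdc φ hφ a₂ y (t * c) hy.1 (by positivity) fun s hs => ?_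
        rw [hφdef, iteratedDeriv_modelPhase hL hX _ _ _ _ _ hk, abs_mul, abs_of_pos ht0]
        exact mul_le_mul_of_nonneg_left (hLX p hp s ⟨hs.1, hs.2.trans hy.2⟩ v₁ hw) ht0.le
      · calc A * (t * c) ^ (-(1 : ℝ) / k) * M1 * (b₂ - a₂)
            ≤ A * (t ^ (-(1 : ℝ) / 4) * c ^ (-(1 : ℝ) / k)) * M1 * (b₂ - a₂) := by gcongr
          _ = (A * c ^ (-(1 : ℝ) / k) * M1 * (b₂ - a₂)) * t ^ (-(1 : ℝ) / 4) := by ring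
          _ ≤ _ := mul_le_mul_of_nonneg_right (by nlinarith) htp.le
    · have : ∀ y, γ (p, y) = 0 := fun y => hzero p y fun h => hp (Set.Ioo_subset_Icc_self h.1)
      simp only [this, Complex.ofReal_zero, mul_zero, intervalIntegral.integral_zero, norm_zero]
      positivity

theorem hasCompactSupport_of_tsupport_subset_box {γ : ℝ × ℝ → ℝ} {a₁ b₁ a₂ b₂ : ℝ}
    (hs : tsupport γ ⊆ Set.Ioo a₁ b₁ ×ˢ Set.Ioo a₂ b₂) : HasCompactSupport γ := by
  refine HasCompactSupport.of_support_subset_isCompact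
    ((isCompact_Icc (a := a₁) (b := b₁)).prod (isCompact_Icc (a := a₂) (b := b₂)))
    ((subset_tsupport γ).trans (hs.trans ?_))
  exact Set.prod_mono Set.Ioo_subset_Icc_self Set.Ioo_subset_Icc_self

theorem integral_fderiv_fst_eq_zero {G : ℝ × ℝ → ℂ} (hG : ContDiff ℝ 1 G)
    (hc : HasCompactSupport G) : ∫ z, fderiv ℝ G z (1, 0) = 0 := by
  have hcont : Continuous fun z => fderiv ℝ G z ((1 : ℝ), (0 : ℝ)) :=
    (hG.continuous_fderiv (by simp)).clm_apply continuous_const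
  have hcs : HasCompactSupport fun z => fderiv ℝ G z ((1 : ℝ), (0 : ℝ)) :=
    (hc.fderiv (𝕜 := ℝ)).comp_left (g := fun l : ℝ × ℝ →L[ℝ] ℂ => l (1, 0)) rfl
  have hemb : ∀ y : ℝ, Topology.IsClosedEmbedding fun x : ℝ => (x, y) := fun y =>
    Topology.IsClosedEmbedding.of_continuous_injective_isClosedMap (by fun_prop)
      (fun a b h => (Prod.ext_iff.1 h).1) (isClosedMap_prodMk_right y)
  rw [Measure.volume_eq_prod, integral_prod_symm _
    (by rw [← Measure.volume_eq_prod]; exact hcont.integrable_of_hasCompactSupport hcs)]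
  have : ∀ y : ℝ, ∫ x : ℝ, fderiv ℝ G (x, y) (1, 0) = 0 := fun y => by
    refine integral_eq_zero_of_hasDerivAt_of_integrable (f := fun x => G (x, y)) (fun x => ?_)
      ((hcont.comp (by fun_prop : Continuous fun x : ℝ => (x, y))).integrable_of_hasCompactSupport
        (hcs.comp_isClosedEmbedding (hemb y)))
      ((hG.continuous.comp (by fun_prop)).integrable_of_hasCompactSupport
        (hc.comp_isClosedEmbedding (hemb y)))
    exact (hG.differentiable (by simp) (x, y)).hasFDerivAt.comp_hasDerivAt x
      ((hasDerivAt_id x).prodMk (hasDerivAt_const x y))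
  simp only [this, integral_zero]

theorem integral_inv_one_add_mul_sq {t : ℝ} (ht : 0 < t) (v : ℝ) :
    Integrable (fun p : ℝ => (1 + t * (p - v) ^ 2)⁻¹) ∧
      ∫ p : ℝ, (1 + t * (p - v) ^ 2)⁻¹ = π * t ^ (-(1 : ℝ) / 2) := by
  have e : (fun p : ℝ => (1 + t * (p - v) ^ 2)⁻¹) =
      fun p => (fun x => (fun u : ℝ => (1 + u ^ 2)⁻¹) (√t * x)) (p - v) := by
    ext p
    simp only [mul_pow, Real.sq_sqrt ht.le]
  rw [e]
  constructor
  · exact ((integrable_inv_one_add_sq).comp_mul_left' (Real.sqrt_pos.2 ht).ne').comp_sub_right v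
  · rw [integral_sub_right_eq_self (fun x => (fun u : ℝ => (1 + u ^ 2)⁻¹) (√t * x)) v,
      Measure.integral_comp_mul_left (fun u : ℝ => (1 + u ^ 2)⁻¹) (√t), integral_univ_inv_one_add_sq,
      abs_of_nonneg (by positivity),
      smul_eq_mul, mul_comm, Real.sqrt_eq_rpow, ← Real.rpow_neg ht.le]
    norm_num

/-- Integrating the inner bound against a weight concentrated near the critical line. -/
theorem norm_integral_weight_le {γ φ : ℝ × ℝ → ℝ} (hφ : Continuous φ) (hγ : Continuous γ)
    {a₁ b₁ a₂ b₂ : ℝ} (h₁ : a₁ < b₁) (hs : tsupport γ ⊆ Set.Ioo a₁ b₁ ×ˢ Set.Ioo a₂ b₂)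
    {C D c₀ t v : ℝ} (ht : 1 ≤ t) (hC : 0 ≤ C) (hD : 0 ≤ D)
    (hF : ∀ p, ‖∫ y, Complex.exp (Complex.I * (φ (p, y) : ℂ)) * (γ (p, y) : ℂ)‖ ≤ C ∧
      (|p - v| ≤ c₀ →
        ‖∫ y, Complex.exp (Complex.I * (φ (p, y) : ℂ)) * (γ (p, y) : ℂ)‖
          ≤ C * t ^ (-(1 : ℝ) / 4)))
    {m : ℝ → ℝ} (hm : Continuous m)
    (hm1 : ∀ p, |m p| ≤ D * ((1 + t * (p - v) ^ 2)⁻¹ + t ^ (-(1 : ℝ) / 2)))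
    (hm2 : ∀ p, c₀ < |p - v| → |m p| ≤ D * t ^ (-1 : ℝ)) :
    ‖∫ z : ℝ × ℝ, Complex.exp (Complex.I * (φ z : ℂ)) * ((m z.1 * γ z : ℝ) : ℂ)‖
      ≤ C * D * (π + 2 * (b₁ - a₁)) * t ^ (-(3 : ℝ) / 4) := by
  have ht0 : 0 < t := by linarith
  have hcs := hasCompactSupport_of_tsupport_subset_box hs
  have hint : Integrable (fun z : ℝ × ℝ =>
      Complex.exp (Complex.I * (φ z : ℂ)) * ((m z.1 * γ z : ℝ) : ℂ)) := by
    refine Continuous.integrable_of_hasCompactSupport (by fun_prop) ?_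
    refine hcs.mono fun z hz => ?_
    contrapose! hz
    simp only [Function.mem_support, not_not] at hz ⊢
    simp [hz]
  rw [Measure.volume_eq_prod, integral_prod _ (by rwa [← Measure.volume_eq_prod])]
  set F : ℝ → ℂ := fun p => ∫ y, Complex.exp (Complex.I * (φ (p, y) : ℂ)) * (γ (p, y) : ℂ)
  have e1 : ∀ p, ∫ y, Complex.exp (Complex.I * (φ (p, y) : ℂ)) * ((m p * γ (p, y) : ℝ) : ℂ)
      = (m p : ℂ) * F p := fun p => by
    rw [← integral_const_mul]
    congr 1; ext y; push_cast; ring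
  simp only [e1]
  have hF0 : ∀ p, p ∉ Set.Icc a₁ b₁ → F p = 0 := fun p hp => by
    have : ∀ y, γ (p, y) = 0 := fun y =>
      image_eq_zero_of_notMem_tsupport fun h => hp (Set.Ioo_subset_Icc_self (hs h).1)
    simp [F, this]
  rw [← setIntegral_eq_integral_of_forall_compl_eq_zero (s := Set.Icc a₁ b₁)
    (fun p hp => by rw [hF0 p hp, mul_zero])]
  obtain ⟨hκi, hκ⟩ := integral_inv_one_add_mul_sq ht0 v
  set κ : ℝ → ℝ := fun p => (1 + t * (p - v) ^ 2)⁻¹ with hκdef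
  have hκ0 : ∀ p, 0 ≤ κ p := fun p => by positivity
  have p4 : 0 < t ^ (-(1 : ℝ) / 4) := rpow_pos_of_pos ht0 _
  have p34 : t ^ (-(1 : ℝ) / 2) * t ^ (-(1 : ℝ) / 4) = t ^ (-(3 : ℝ) / 4) := by
    rw [← rpow_add ht0]; norm_num
  have p1 : t ^ (-1 : ℝ) ≤ t ^ (-(3 : ℝ) / 4) := rpow_le_rpow_of_exponent_le ht (by norm_num)
  have p34' : 0 < t ^ (-(3 : ℝ) / 4) := rpow_pos_of_pos ht0 _
  have hpt : ∀ p, ‖(m p : ℂ) * F p‖ ≤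
      C * D * (t ^ (-(1 : ℝ) / 4) * κ p + 2 * t ^ (-(3 : ℝ) / 4)) := fun p => by
    rw [norm_mul, Complex.norm_real, Real.norm_eq_abs]
    rcases le_or_gt |p - v| c₀ with h | h
    · calc |m p| * ‖F p‖ ≤ (D * (κ p + t ^ (-(1 : ℝ) / 2))) * (C * t ^ (-(1 : ℝ) / 4)) :=
            mul_le_mul (hm1 p) ((hF p).2 h) (norm_nonneg _) ((abs_nonneg _).trans (hm1 p))
        _ = C * D * (t ^ (-(1 : ℝ) / 4) * κ p + t ^ (-(1 : ℝ) / 2) * t ^ (-(1 : ℝ) / 4)) := by ring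
        _ ≤ _ := by
          rw [p34]
          refine mul_le_mul_of_nonneg_left ?_ (by positivity)
          linarith
    · calc |m p| * ‖F p‖ ≤ (D * t ^ (-1 : ℝ)) * C :=
            mul_le_mul (hm2 p h) (hF p).1 (norm_nonneg _) ((abs_nonneg _).trans (hm2 p h))
        _ = C * D * t ^ (-1 : ℝ) := by ring
        _ ≤ _ := by
          refine mul_le_mul_of_nonneg_left ?_ (by positivity)
          nlinarith [mul_nonneg p4.le (hκ0 p)]
  refine (norm_integral_le_of_norm_le (g := fun p =>
    C * D * (t ^ (-(1 : ℝ) / 4) * κ p + 2 * t ^ (-(3 : ℝ) / 4)))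
    (((hκi.integrableOn.const_mul _).add (integrable_const _)).const_mul _)
    (Filter.Eventually.of_forall hpt)).trans ?_
  rw [integral_const_mul, integral_add (hκi.integrableOn.const_mul _) (integrable_const _),
    integral_const_mul]
  have hle : ∫ p in Set.Icc a₁ b₁, κ p ≤ π * t ^ (-(1 : ℝ) / 2) := by
    rw [← hκ]
    exact setIntegral_le_integral hκi (Filter.Eventually.of_forall hκ0)
  have hcst : ∫ _ in Set.Icc a₁ b₁, 2 * t ^ (-(3 : ℝ) / 4)
      = (b₁ - a₁) * (2 * t ^ (-(3 : ℝ) / 4)) := by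
    simp [h₁.le]
  rw [hcst, mul_assoc (C * D)]
  refine mul_le_mul_of_nonneg_left ?_ (by positivity)
  calc _ ≤ t ^ (-(1 : ℝ) / 4) * (π * t ^ (-(1 : ℝ) / 2))
        + (b₁ - a₁) * (2 * t ^ (-(3 : ℝ) / 4)) := by gcongr
    _ = π * (t ^ (-(1 : ℝ) / 2) * t ^ (-(1 : ℝ) / 4))
        + (b₁ - a₁) * (2 * t ^ (-(3 : ℝ) / 4)) := by ring
    _ = _ := by rw [p34]; ring

/-- One integration by parts across the critical line. -/
theorem integral_modelPhase_eq {L X β : ℝ × ℝ → ℝ} (hL : ContDiff ℝ ∞ L) (hX : ContDiff ℝ ∞ X)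
    (hβ : ContDiff ℝ ∞ β) (hc : HasCompactSupport β)
    (hLX : ∀ z ∈ tsupport β, pd1 L z = X z) {t : ℝ} (ht : 0 < t) (v₁ v₂ : ℝ) :
    ∫ z, Complex.exp (Complex.I * (modelPhase L X t v₁ v₂ z : ℂ)) * ((β z * pd1 X z : ℝ) : ℂ) =
      (∫ z : ℝ × ℝ, Complex.exp (Complex.I * (modelPhase L X t v₁ v₂ z : ℂ)) *
        (((1 + t * (z.1 - v₁) ^ 2)⁻¹ * (β z * pd1 X z) : ℝ) : ℂ))
      - Complex.I * (∫ z : ℝ × ℝ, Complex.exp (Complex.I * (modelPhase L X t v₁ v₂ z : ℂ)) *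
        (((z.1 - v₁) * (1 + t * (z.1 - v₁) ^ 2)⁻¹ * pd1 β z : ℝ) : ℂ))
      - Complex.I * (∫ z : ℝ × ℝ, Complex.exp (Complex.I * (modelPhase L X t v₁ v₂ z : ℂ)) *
        (((1 - t * (z.1 - v₁) ^ 2) * ((1 + t * (z.1 - v₁) ^ 2)⁻¹) ^ 2 * β z : ℝ) : ℂ)) := by
  set φ := modelPhase L X t v₁ v₂ with hφdef
  have hφ : ContDiff ℝ ∞ φ := contDiff_modelPhase hL hX t v₁ v₂
  have hpos : ∀ x : ℝ, 0 < 1 + t * (x - v₁) ^ 2 := fun x => by positivity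
  set m : ℝ → ℝ := fun x => (x - v₁) * (1 + t * (x - v₁) ^ 2)⁻¹ with hm
  have hmc : ContDiff ℝ ∞ m := by
    refine ContDiff.mul (by fun_prop) (ContDiff.inv (by fun_prop) fun x => (hpos x).ne')
  have hmd : ∀ x, HasDerivAt m
      ((1 - t * (x - v₁) ^ 2) * ((1 + t * (x - v₁) ^ 2)⁻¹) ^ 2) x := fun x => by
    have h1 : HasDerivAt (fun x => x - v₁) 1 x := (hasDerivAt_id x).sub_const _
    have h2 := h1.mul ((((h1.pow 2).const_mul t).const_add 1).inv (hpos x).ne')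
    refine h2.congr_deriv ?_
    have := (hpos x).ne'
    simp only [Pi.pow_apply, Pi.inv_apply]
    field_simp
    push_cast
    ring
  set G : ℝ × ℝ → ℂ := fun z => Complex.exp (Complex.I * (φ z : ℂ)) * ((m z.1 * β z : ℝ) : ℂ)
    with hG
  have hofR : ∀ {F : ℝ × ℝ → ℝ}, ContDiff ℝ ∞ F → ContDiff ℝ 1 fun z => (F z : ℂ) := fun h =>
    (Complex.ofRealCLM.contDiff.comp h).of_le (by simp)
  have hGc : ContDiff ℝ 1 G :=
    (ContDiff.cexp (contDiff_const.mul (hofR hφ))).mul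
      (hofR ((hmc.comp contDiff_fst).mul hβ))
  have hGs : HasCompactSupport G := hc.mono fun z hz => by
    contrapose! hz
    simp only [Function.mem_support, not_not] at hz ⊢
    simp [hG, hz]
  have hD : ∀ z : ℝ × ℝ, fderiv ℝ G z (1, 0) =
      Complex.exp (Complex.I * (φ z : ℂ)) * (Complex.I * (pd1 φ z : ℂ)) * ((m z.1 * β z : ℝ) : ℂ) +
      Complex.exp (Complex.I * (φ z : ℂ)) *
        ((((1 - t * (z.1 - v₁) ^ 2) * ((1 + t * (z.1 - v₁) ^ 2)⁻¹) ^ 2) * β z +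
          m z.1 * pd1 β z : ℝ) : ℂ) := by
    rintro ⟨x, y⟩
    have h1 := (hGc.differentiable (by simp) (x, y)).hasFDerivAt.comp_hasDerivAt x
      ((hasDerivAt_id x).prodMk (hasDerivAt_const x y))
    have h2 := (hasDerivAt_cexp_phase (hasDerivAt_pd1 (hφ.differentiableAt_infty (x, y)))).mul
      ((hmd x).mul (hasDerivAt_pd1 (hβ.differentiableAt_infty (x, y)))).ofReal_comp
    exact h1.unique h2
  have hφd : ∀ z : ℝ × ℝ, pd1 φ z * β z = -(t * (z.1 - v₁)) * (β z * pd1 X z) := by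
    rintro ⟨x, y⟩
    by_cases hz : (x, y) ∈ tsupport β
    · have h1 := hasDerivAt_pd1 (hφ.differentiableAt_infty (x, y))
      have h2 := (((hasDerivAt_pd1 (hL.differentiableAt_infty (x, y))).const_add (v₂ * y)).sub
        (((hasDerivAt_id x).sub_const v₁).mul
          (hasDerivAt_pd1 (hX.differentiableAt_infty (x, y))))).const_mul t
      have h3 := h1.unique h2
      rw [h3, hLX _ hz]
      simp only [id]
      ring
    · rw [image_eq_zero_of_notMem_tsupport hz]; ring
  have h0 := integral_fderiv_fst_eq_zero hGc hGs
  have hint : ∀ {F : ℝ × ℝ → ℝ}, Continuous F → (∀ z, z ∉ tsupport β → F z = 0) →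
      Integrable fun z => Complex.exp (Complex.I * (φ z : ℂ)) * (F z : ℂ) := fun {F} hF hz => by
    have := hφ.continuous
    refine Continuous.integrable_of_hasCompactSupport (by fun_prop) ?_
    refine HasCompactSupport.of_support_subset_isCompact hc fun z hz' => ?_
    by_contra h
    exact hz' (by simp [hz z h])
  have hb0 : ∀ z, z ∉ tsupport β → β z = 0 := fun z h => image_eq_zero_of_notMem_tsupport h
  have hb1 : ∀ z, z ∉ tsupport β → pd1 β z = 0 := fun z h =>
    image_eq_zero_of_notMem_tsupport fun h' => h (tsupport_pd1_subset β h')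
  have cκ : Continuous fun z : ℝ × ℝ => (1 + t * (z.1 - v₁) ^ 2)⁻¹ :=
    Continuous.inv₀ (by fun_prop) fun z => (hpos z.1).ne'
  have cX := hX.pd1.continuous
  have cβ := hβ.continuous
  have cβ' := hβ.pd1.continuous
  have i1 := hint (F := fun z => (1 + t * (z.1 - v₁) ^ 2)⁻¹ * (β z * pd1 X z)) (by fun_prop)
    (fun z h => by rw [hb0 z h]; ring)
  have i2 := hint (F := fun z => (z.1 - v₁) * (1 + t * (z.1 - v₁) ^ 2)⁻¹ * pd1 β z) (by fun_prop)
    (fun z h => by rw [hb1 z h]; ring)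
  have i3 := hint (F := fun z =>
    (1 - t * (z.1 - v₁) ^ 2) * ((1 + t * (z.1 - v₁) ^ 2)⁻¹) ^ 2 * β z) (by fun_prop)
    (fun z h => by rw [hb0 z h]; ring)
  have i4 : Integrable fun z => fderiv ℝ G z ((1 : ℝ), (0 : ℝ)) :=
    ((hGc.continuous_fderiv (by simp)).clm_apply
      continuous_const).integrable_of_hasCompactSupport
        ((hGs.fderiv (𝕜 := ℝ)).comp_left (g := fun l : ℝ × ℝ →L[ℝ] ℂ => l (1, 0)) rfl)
  have key : (fun z => Complex.exp (Complex.I * (φ z : ℂ)) * ((β z * pd1 X z : ℝ) : ℂ)) =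
      fun z => Complex.exp (Complex.I * (φ z : ℂ)) *
          (((1 + t * (z.1 - v₁) ^ 2)⁻¹ * (β z * pd1 X z) : ℝ) : ℂ)
        - Complex.I * (Complex.exp (Complex.I * (φ z : ℂ)) *
          (((z.1 - v₁) * (1 + t * (z.1 - v₁) ^ 2)⁻¹ * pd1 β z : ℝ) : ℂ))
        - Complex.I * (Complex.exp (Complex.I * (φ z : ℂ)) *
          (((1 - t * (z.1 - v₁) ^ 2) * ((1 + t * (z.1 - v₁) ^ 2)⁻¹) ^ 2 * β z : ℝ) : ℂ))
        + Complex.I * fderiv ℝ G z (1, 0) := by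
    ext z
    rw [hD z]
    have e1 : ((pd1 φ z : ℝ) : ℂ) * ((m z.1 * β z : ℝ) : ℂ) =
        ((m z.1 * (-(t * (z.1 - v₁)) * (β z * pd1 X z)) : ℝ) : ℂ) := by
      rw [← hφd z]; push_cast; ring
    have e2 : β z * pd1 X z = (1 + t * (z.1 - v₁) ^ 2)⁻¹ * (β z * pd1 X z)
        - m z.1 * (-(t * (z.1 - v₁)) * (β z * pd1 X z)) := by
      have := (hpos z.1).ne'
      simp only [hm]
      field_simp
      ring
    rw [mul_assoc _ (Complex.I * _), mul_assoc Complex.I, e1]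
    nth_rewrite 1 [e2]
    simp only [hm]
    push_cast
    linear_combination (-(Complex.exp (Complex.I * (φ z : ℂ))) * (((z.1 : ℂ) - v₁) *
      (1 + t * ((z.1 : ℂ) - v₁) ^ 2)⁻¹ * (-(t * ((z.1 : ℂ) - v₁)) * (β z * pd1 X z)))) *
      Complex.I_sq
  have j2 := i2.const_mul Complex.I
  have j3 := i3.const_mul Complex.I
  have j4 := i4.const_mul Complex.I
  rw [key]
  have s1 := integral_add ((i1.sub j2).sub j3) j4
  have s2 := integral_sub (i1.sub j2) j3
  have s3 := integral_sub i1 j2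
  simp only [Pi.sub_apply, integral_const_mul, h0, mul_zero, add_zero] at s1 s2 s3
  rw [s1, s2, s3]

/-- Decay of the model oscillatory integral, uniformly in the velocity. -/
theorem exists_model_bound {L X β : ℝ × ℝ → ℝ} (hL : ContDiff ℝ ∞ L) (hX : ContDiff ℝ ∞ X)
    (hβ : ContDiff ℝ ∞ β) {a₁ b₁ a₂ b₂ : ℝ} (h₁ : a₁ < b₁) (h₂ : a₂ < b₂)
    (hs : tsupport β ⊆ Set.Ioo a₁ b₁ ×ˢ Set.Ioo a₂ b₂)
    (hpd : ∀ z ∈ tsupport β, pd1 L z = X z)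
    {k : ℕ} (hk : 2 ≤ k) (hk4 : k ≤ 4) {c c₀ : ℝ} (hc : 0 < c) (hc₀ : 0 < c₀)
    (hLX : ∀ p ∈ Set.Icc a₁ b₁, ∀ y ∈ Set.Icc a₂ b₂, ∀ v₁, |p - v₁| ≤ c₀ →
      c ≤ |iteratedDeriv k (fun y => L (p, y)) y
        - (p - v₁) * iteratedDeriv k (fun y => X (p, y)) y|) :
    ∃ C : ℝ, 0 < C ∧ ∀ t v₁ v₂ : ℝ, 1 ≤ t →
      ‖∫ z, Complex.exp (Complex.I * (modelPhase L X t v₁ v₂ z : ℂ)) *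
        ((β z * pd1 X z : ℝ) : ℂ)‖ ≤ C * t ^ (-(3 : ℝ) / 4) := by
  have hs1 : tsupport (fun z => β z * pd1 X z) ⊆ Set.Ioo a₁ b₁ ×ˢ Set.Ioo a₂ b₂ :=
    (tsupport_mul_subset_left).trans hs
  have hs2 := (tsupport_pd1_subset β).trans hs
  obtain ⟨C1, hC1, hF1⟩ := exists_inner_bound hL hX (hβ.mul hX.pd1) h₂ hs1 hk hk4 hc hLX
  obtain ⟨C2, hC2, hF2⟩ := exists_inner_bound hL hX hβ.pd1 h₂ hs2 hk hk4 hc hLX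
  obtain ⟨C3, hC3, hF3⟩ := exists_inner_bound hL hX hβ h₂ hs hk hk4 hc hLX
  set D : ℝ := 1 + (c₀ ^ 2)⁻¹ + c₀⁻¹ with hD
  have hD0 : 0 < D := by positivity
  set M := π + 2 * (b₁ - a₁) with hM
  have hM0 : 0 < M := by have := pi_pos; linarith
  refine ⟨(C1 + C2 + C3) * D * M, by positivity, fun t v₁ v₂ ht => ?_⟩
  have ht0 : 0 < t := by linarith
  have hφ := (contDiff_modelPhase hL hX t v₁ v₂).continuous
  have hpos : ∀ p : ℝ, 0 < 1 + t * (p - v₁) ^ 2 := fun p => by positivity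
  have hκ0 : ∀ p : ℝ, 0 < (1 + t * (p - v₁) ^ 2)⁻¹ := fun p => inv_pos.2 (hpos p)
  have hsq : t ^ (-(1 : ℝ) / 2) = (√t)⁻¹ := by
    rw [Real.sqrt_eq_rpow, ← Real.rpow_neg ht0.le]; norm_num
  have hst : 0 < √t := Real.sqrt_pos.2 ht0
  have hss : √t * √t = t := Real.mul_self_sqrt ht0.le
  have hp2 : 0 < t ^ (-(1 : ℝ) / 2) := rpow_pos_of_pos ht0 _
  have hinv : t ^ (-1 : ℝ) = t⁻¹ := Real.rpow_neg_one t
  have cκ : Continuous fun p : ℝ => (1 + t * (p - v₁) ^ 2)⁻¹ :=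
    Continuous.inv₀ (by fun_prop) fun p => (hpos p).ne'
  have bκ : ∀ p, c₀ < |p - v₁| → (1 + t * (p - v₁) ^ 2)⁻¹ ≤ D * t⁻¹ := fun p hp => by
    have h1 : c₀ ^ 2 ≤ (p - v₁) ^ 2 := by
      rw [← sq_abs (p - v₁)]; gcongr
    calc (1 + t * (p - v₁) ^ 2)⁻¹ ≤ (t * c₀ ^ 2)⁻¹ := by
          gcongr; nlinarith
      _ = (c₀ ^ 2)⁻¹ * t⁻¹ := by rw [mul_inv]; ring
      _ ≤ D * t⁻¹ := by
          gcongr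
          have : 0 < c₀⁻¹ := by positivity
          linarith
  have bw1 : ∀ p, |(p - v₁) * (1 + t * (p - v₁) ^ 2)⁻¹| ≤ (√t)⁻¹ := fun p => by
    rw [abs_mul, abs_of_pos (hκ0 p), ← div_eq_mul_inv, div_le_iff₀ (hpos p), ← sq_abs (p - v₁),
      inv_mul_eq_div, le_div_iff₀ hst]
    nlinarith [sq_nonneg (√t * |p - v₁| - 1), sq_nonneg (√t * |p - v₁|)]
  have bw2 : ∀ p, c₀ < |p - v₁| →
      |(p - v₁) * (1 + t * (p - v₁) ^ 2)⁻¹| ≤ D * t⁻¹ := fun p hp => by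
    have h0 : 0 < |p - v₁| := hc₀.trans hp
    calc |(p - v₁) * (1 + t * (p - v₁) ^ 2)⁻¹| = |p - v₁| * (1 + t * |p - v₁| ^ 2)⁻¹ := by
          rw [abs_mul, abs_of_pos (hκ0 p), sq_abs]
      _ ≤ |p - v₁| * (t * |p - v₁| ^ 2)⁻¹ := by
          gcongr; linarith
      _ = |p - v₁|⁻¹ * t⁻¹ := by field_simp
      _ ≤ c₀⁻¹ * t⁻¹ := by gcongr
      _ ≤ D * t⁻¹ := by
          gcongr
          have : 0 < (c₀ ^ 2)⁻¹ := by positivity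
          linarith
  have b3 : ∀ p, |(1 - t * (p - v₁) ^ 2) * ((1 + t * (p - v₁) ^ 2)⁻¹) ^ 2|
      ≤ (1 + t * (p - v₁) ^ 2)⁻¹ := fun p => by
    have hw : 0 ≤ t * (p - v₁) ^ 2 := by positivity
    rw [abs_mul, abs_pow, abs_of_pos (hκ0 p), pow_two (_⁻¹), ← mul_assoc]
    refine mul_le_of_le_one_left (hκ0 p).le ?_
    rw [← div_eq_mul_inv, div_le_one (hpos p)]
    exact abs_le.2 ⟨by linarith, by linarith⟩
  have hD1 : 1 ≤ D := by
    have : 0 < (c₀ ^ 2)⁻¹ + c₀⁻¹ := by positivity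
    linarith
  have B1 := norm_integral_weight_le hφ (hβ.mul hX.pd1).continuous h₁ hs1 ht hC1.le hD0.le
    (fun p => hF1 t v₁ v₂ p ht) cκ
    (fun p => by
      rw [abs_of_pos (hκ0 p)]
      nlinarith [hκ0 p])
    (fun p hp => by rw [abs_of_pos (hκ0 p), hinv]; exact bκ p hp)
  have B2 := norm_integral_weight_le hφ hβ.pd1.continuous h₁ hs2 ht hC2.le hD0.le
    (fun p => hF2 t v₁ v₂ p ht) (m := fun p => (p - v₁) * (1 + t * (p - v₁) ^ 2)⁻¹) (by fun_prop)
    (fun p => by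
      refine (bw1 p).trans ?_
      rw [← hsq]
      nlinarith [hκ0 p])
    (fun p hp => by rw [hinv]; exact bw2 p hp)
  have B3 := norm_integral_weight_le hφ hβ.continuous h₁ hs ht hC3.le hD0.le
    (fun p => hF3 t v₁ v₂ p ht)
    (m := fun p => (1 - t * (p - v₁) ^ 2) * ((1 + t * (p - v₁) ^ 2)⁻¹) ^ 2) (by fun_prop)
    (fun p => by
      refine (b3 p).trans ?_
      nlinarith [hκ0 p])
    (fun p hp => by rw [hinv]; exact (b3 p).trans (bκ p hp))
  rw [integral_modelPhase_eq hL hX hβ (hasCompactSupport_of_tsupport_subset_box hs) hpd ht0]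
  refine (norm_sub_le _ _).trans ((add_le_add_left (norm_sub_le _ _) _).trans ?_)
  rw [norm_mul, norm_mul, Complex.norm_I, one_mul, one_mul]
  linarith

theorem fderiv_prod_apply (F : ℝ × ℝ → ℝ) (z v : ℝ × ℝ) :
    fderiv ℝ F z v = v.1 * pd1 F z + v.2 * pd2 F z := by
  have : v = v.1 • ((1 : ℝ), (0 : ℝ)) + v.2 • ((0 : ℝ), (1 : ℝ)) := by ext <;> simp
  conv_lhs => rw [this, map_add, map_smul, map_smul]
  rfl

/-- The linear map `(u, w) ↦ (A u + B w, w)`. -/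
def shearCLM (A B : ℝ) : ℝ × ℝ →L[ℝ] ℝ × ℝ :=
  (A • ContinuousLinearMap.fst ℝ ℝ ℝ + B • ContinuousLinearMap.snd ℝ ℝ ℝ).prod
    (ContinuousLinearMap.snd ℝ ℝ ℝ)

theorem shearCLM_apply (A B : ℝ) (v : ℝ × ℝ) : shearCLM A B v = (A * v.1 + B * v.2, v.2) := rfl

theorem det_shearCLM (A B : ℝ) : (shearCLM A B).det = A := by
  have : shearCLM A B = LinearMap.toContinuousLinearMap
      (Matrix.toLin (Module.Basis.finTwoProd ℝ) (Module.Basis.finTwoProd ℝ) !![A, B; 0, 1]) := by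
    rw [Matrix.toLin_finTwoProd_toContinuousLinearMap]
    ext <;> simp [shearCLM_apply]
  rw [this]
  simp [LinearMap.det_toContinuousLinearMap, LinearMap.det_toLin, Matrix.det_fin_two_of]

/-- `shearCLM` as an equivalence. -/
def shearEquiv {A : ℝ} (hA : A ≠ 0) (B : ℝ) : (ℝ × ℝ) ≃L[ℝ] ℝ × ℝ :=
  ContinuousLinearEquiv.equivOfInverse (shearCLM A B) (shearCLM A⁻¹ (-(A⁻¹ * B)))
    (fun v => by simp only [shearCLM_apply]; ext <;> simp; field_simp; ring)
    (fun v => by simp only [shearCLM_apply]; ext <;> simp; field_simp; ring)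

theorem hasFDerivAt_prodMk_snd {F : ℝ × ℝ → ℝ} {z : ℝ × ℝ} (hF : DifferentiableAt ℝ F z) :
    HasFDerivAt (fun z => (F z, z.2)) (shearCLM (pd1 F z) (pd2 F z)) z := by
  refine (hF.hasFDerivAt.prodMk hasFDerivAt_snd).congr_fderiv ?_
  ext <;> simp [shearCLM_apply, fderiv_prod_apply]

/-- A smooth partial inverse, in the first variable, of the map `(x, y) ↦ (∂₁ f, y)`. -/
structure PartialLegendre (f X : ℝ × ℝ → ℝ) (U V : Set (ℝ × ℝ)) : Prop where
  isOpen_U : IsOpen U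
  isOpen_V : IsOpen V
  contDiff : ContDiff ℝ ∞ X
  pd1_eq : ∀ z ∈ V, pd1 f (X z, z.2) = z.1
  mem_U : ∀ z ∈ V, (X z, z.2) ∈ U
  ne_zero : ∀ z ∈ U, pd1 (pd1 f) z ≠ 0
  mem_V : ∀ z ∈ U, (pd1 f z, z.2) ∈ V
  left_inv : ∀ z ∈ U, X (pd1 f z, z.2) = z.1

theorem exists_partialLegendre {f : ℝ × ℝ → ℝ} (hf : ContDiff ℝ ∞ f) {p : ℝ × ℝ}
    (hp : pd1 (pd1 f) p ≠ 0) : ∃ X U V, p ∈ U ∧ PartialLegendre f X U V := by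
  set T : ℝ × ℝ → ℝ × ℝ := fun z => (pd1 f z, z.2) with hT
  have hTc : ContDiff ℝ ∞ T := hf.pd1.prodMk contDiff_snd
  have hTd : ∀ z (h : pd1 (pd1 f) z ≠ 0),
      HasFDerivAt T (shearEquiv h (pd2 (pd1 f) z) : (ℝ × ℝ) →L[ℝ] ℝ × ℝ) z := fun z h =>
    hasFDerivAt_prodMk_snd (hf.pd1.differentiableAt_infty z)
  set e := (hTc.contDiffAt (x := p)).toOpenPartialHomeomorph T (hTd p hp) (by simp) with he
  have heT : (e : ℝ × ℝ → ℝ × ℝ) = T := rfl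
  have hpe : p ∈ e.source := (hTc.contDiffAt (x := p)).mem_toOpenPartialHomeomorph_source _ _
  have hS : IsOpen {z | pd1 (pd1 f) z ≠ 0} := isOpen_ne_fun hf.pd1.pd1.continuous continuous_const
  set W := e.target ∩ e.symm ⁻¹' {z | pd1 (pd1 f) z ≠ 0} with hW
  have hWo : IsOpen W := e.isOpen_inter_preimage_symm hS
  have hpW : T p ∈ W := by
    refine ⟨e.map_source hpe, ?_⟩
    have : e.symm (T p) = p := e.left_inv hpe
    simpa [this] using hp
  have hsm : ∀ z ∈ W, ContDiffAt ℝ ∞ e.symm z := fun z hz =>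
    e.contDiffAt_symm hz.1 (hTd _ hz.2) hTc.contDiffAt
  obtain ⟨r, hr, hrW⟩ := Metric.nhds_basis_closedBall.mem_iff.1 (hWo.mem_nhds hpW)
  let b : ContDiffBump (T p) := ⟨r / 2, r, by positivity, by linarith⟩
  have hbs : tsupport b ⊆ W := by rw [b.tsupport_eq]; exact hrW
  set X : ℝ × ℝ → ℝ := fun z => b z * (e.symm z).1 with hX
  have hXc : ContDiff ℝ ∞ X := by
    rw [contDiff_iff_contDiffAt]
    intro z
    by_cases hz : z ∈ tsupport b
    · exact b.contDiff.contDiffAt.mul (contDiff_fst.contDiffAt.comp z (hsm z (hbs hz)))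
    · refine (contDiffAt_const (c := (0 : ℝ))).congr_of_eventuallyEq ?_
      filter_upwards [(isClosed_tsupport b).isOpen_compl.mem_nhds hz] with w hw
      simp [hX, image_eq_zero_of_notMem_tsupport hw]
  set V := Metric.ball (T p) (r / 2) with hV
  have hVW : V ⊆ W := (Metric.ball_subset_closedBall.trans
    (Metric.closedBall_subset_closedBall (by linarith))).trans hrW
  have hXV : ∀ z ∈ V, X z = (e.symm z).1 := fun z hz => by
    simp only [hX]
    rw [b.one_of_mem_closedBall (Metric.ball_subset_closedBall hz), one_mul]
  have hTe : ∀ z ∈ V, T (e.symm z) = z := fun z hz => e.right_inv (hVW hz).1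
  have hN : ∀ z ∈ V, (X z, z.2) = e.symm z := fun z hz => by
    have : (T (e.symm z)).2 = z.2 := by rw [hTe z hz]
    ext
    · exact hXV z hz
    · exact this.symm
  refine ⟨X, e.source ∩ {z | pd1 (pd1 f) z ≠ 0} ∩ T ⁻¹' V, V, ⟨⟨hpe, hp⟩, ?_⟩,
    (e.open_source.inter hS).inter (Metric.isOpen_ball.preimage hTc.continuous),
    Metric.isOpen_ball, hXc, fun z hz => ?_, fun z hz => ?_, fun z hz => hz.1.2,
    fun z hz => hz.2, fun z hz => ?_⟩
  · exact Metric.mem_ball_self (by positivity)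
  · rw [hN z hz]
    exact congrArg Prod.fst (hTe z hz)
  · rw [hN z hz]
    refine ⟨⟨e.map_target (hVW hz).1, (hVW hz).2⟩, ?_⟩
    rw [Set.mem_preimage, hTe z hz]
    exact hz
  · rw [hXV _ hz.2]
    exact congrArg Prod.fst (e.left_inv hz.1.1)

theorem pd1_comp {F X : ℝ × ℝ → ℝ} {z : ℝ × ℝ} (hF : DifferentiableAt ℝ F (X z, z.2))
    (hX : DifferentiableAt ℝ X z) :
    pd1 (fun z => F (X z, z.2)) z = pd1 F (X z, z.2) * pd1 X z := by
  have h := hF.hasFDerivAt.comp z (hasFDerivAt_prodMk_snd hX)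
  change fderiv ℝ (F ∘ fun z => (X z, z.2)) z (1, 0) = _
  rw [h.fderiv, ContinuousLinearMap.comp_apply, fderiv_prod_apply]
  simp [shearCLM_apply, mul_comm]

theorem pd2_comp {F X : ℝ × ℝ → ℝ} {z : ℝ × ℝ} (hF : DifferentiableAt ℝ F (X z, z.2))
    (hX : DifferentiableAt ℝ X z) :
    pd2 (fun z => F (X z, z.2)) z = pd1 F (X z, z.2) * pd2 X z + pd2 F (X z, z.2) := by
  have h := hF.hasFDerivAt.comp z (hasFDerivAt_prodMk_snd hX)
  change fderiv ℝ (F ∘ fun z => (X z, z.2)) z (0, 1) = _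
  rw [h.fderiv, ContinuousLinearMap.comp_apply, fderiv_prod_apply]
  simp [shearCLM_apply, mul_comm]

theorem Filter.EventuallyEq.pd1_eq {F G : ℝ × ℝ → ℝ} {z : ℝ × ℝ} (h : F =ᶠ[nhds z] G) :
    pd1 F z = pd1 G z := by
  unfold pd1; rw [h.fderiv_eq]

theorem Filter.EventuallyEq.pd2_eq {F G : ℝ × ℝ → ℝ} {z : ℝ × ℝ} (h : F =ᶠ[nhds z] G) :
    pd2 F z = pd2 G z := by
  unfold pd2; rw [h.fderiv_eq]

/-- Derivative along the curves `∂₁ f = const`, parametrised by the second variable. -/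
def levelDeriv (f F : ℝ × ℝ → ℝ) (z : ℝ × ℝ) : ℝ :=
  pd2 F z - pd2 (pd1 f) z / pd1 (pd1 f) z * pd1 F z

theorem iteratedDeriv_eq_pd2_iterate {F : ℝ × ℝ → ℝ} (hF : ContDiff ℝ ∞ F) (p : ℝ) (k : ℕ) :
    ContDiff ℝ ∞ (pd2^[k] F) ∧
      iteratedDeriv k (fun y => F (p, y)) = fun y => (pd2^[k] F) (p, y) := by
  induction k with
  | zero => exact ⟨hF, by simp⟩
  | succ k ih =>
    rw [Function.iterate_succ_apply', iteratedDeriv_succ, ih.2]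
    exact ⟨ih.1.pd2, funext fun y => (hasDerivAt_pd2 (ih.1.differentiableAt_infty _)).deriv⟩

/-- The partial Legendre transform. -/
def legendreFun (f X : ℝ × ℝ → ℝ) (z : ℝ × ℝ) : ℝ := z.1 * X z - f (X z, z.2)

theorem contDiff_legendreFun {f X : ℝ × ℝ → ℝ} (hf : ContDiff ℝ ∞ f) (hX : ContDiff ℝ ∞ X) :
    ContDiff ℝ ∞ (legendreFun f X) := by
  unfold legendreFun
  exact (contDiff_fst.mul hX).sub (hf.comp (hX.prodMk contDiff_snd))

namespace PartialLegendre

variable {f X : ℝ × ℝ → ℝ} {U V : Set (ℝ × ℝ)}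

theorem pd1_mul (h : PartialLegendre f X U V) (hf : ContDiff ℝ ∞ f) {z : ℝ × ℝ} (hz : z ∈ V) :
    pd1 (pd1 f) (X z, z.2) * pd1 X z = 1 := by
  rw [← pd1_comp (hf.pd1.differentiableAt_infty _) (h.contDiff.differentiableAt_infty z)]
  have : (fun z => pd1 f (X z, z.2)) =ᶠ[nhds z] Prod.fst := by
    filter_upwards [h.isOpen_V.mem_nhds hz] with w hw using h.pd1_eq w hw
  rw [this.pd1_eq]
  simp [pd1, fderiv_fst]

theorem pd2_eq (h : PartialLegendre f X U V) (hf : ContDiff ℝ ∞ f) {z : ℝ × ℝ} (hz : z ∈ V) :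
    pd2 X z = -(pd2 (pd1 f) (X z, z.2) / pd1 (pd1 f) (X z, z.2)) := by
  have h1 := pd2_comp (hf.pd1.differentiableAt_infty _) (h.contDiff.differentiableAt_infty z)
  have : (fun z => pd1 f (X z, z.2)) =ᶠ[nhds z] Prod.fst := by
    filter_upwards [h.isOpen_V.mem_nhds hz] with w hw using h.pd1_eq w hw
  rw [this.pd2_eq] at h1
  have h2 : pd2 Prod.fst z = 0 := by simp [pd2, fderiv_fst]
  rw [h2] at h1
  have := h.ne_zero _ (h.mem_U z hz)
  field_simp
  linarith

theorem pd1_legendreFun (h : PartialLegendre f X U V) (hf : ContDiff ℝ ∞ f) {z : ℝ × ℝ}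
    (hz : z ∈ V) : pd1 (legendreFun f X) z = X z := by
  have hX := h.contDiff.differentiableAt_infty
  have hfd := hf.differentiableAt_infty
  obtain ⟨x, y⟩ := z
  have h1 := hasDerivAt_pd1 ((contDiff_legendreFun hf h.contDiff).differentiableAt_infty (x, y))
  have h2 := ((hasDerivAt_id x).mul (hasDerivAt_pd1 (hX (x, y)))).sub (hasDerivAt_pd1
    ((hf.comp (h.contDiff.prodMk contDiff_snd)).differentiableAt_infty (x, y)))
  have h3 := h1.unique h2
  have h4 := pd1_comp (hfd _) (hX (x, y))
  rw [h.pd1_eq _ hz] at h4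
  rw [h3]
  change 1 * X (x, y) + x * pd1 X (x, y) - pd1 (fun z => f (X z, z.2)) (x, y) = _
  rw [h4]
  ring

theorem pd2_legendreFun (h : PartialLegendre f X U V) (hf : ContDiff ℝ ∞ f) {z : ℝ × ℝ}
    (hz : z ∈ V) : pd2 (legendreFun f X) z = -pd2 f (X z, z.2) := by
  have hX := h.contDiff.differentiableAt_infty
  have hfd := hf.differentiableAt_infty
  obtain ⟨x, y⟩ := z
  have h1 := hasDerivAt_pd2 ((contDiff_legendreFun hf h.contDiff).differentiableAt_infty (x, y))
  have h2 := ((hasDerivAt_pd2 (hX (x, y))).const_mul x).sub (hasDerivAt_pd2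
    ((hf.comp (h.contDiff.prodMk contDiff_snd)).differentiableAt_infty (x, y)))
  have h3 := h1.unique h2
  have h4 := pd2_comp (hfd _) (hX (x, y))
  rw [h.pd1_eq _ hz] at h4
  rw [h3]
  change x * pd2 X (x, y) - pd2 (fun z => f (X z, z.2)) (x, y) = _
  rw [h4]
  ring

theorem contDiffOn_levelDeriv (h : PartialLegendre f X U V) (hf : ContDiff ℝ ∞ f)
    {F : ℝ × ℝ → ℝ} (hF : ContDiffOn ℝ ∞ F U) : ContDiffOn ℝ ∞ (levelDeriv f F) U := by
  have hF' : ContDiffOn ℝ ∞ (fderiv ℝ F) U := hF.fderiv_of_isOpen h.isOpen_U (by simp)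
  have h1 : ContDiffOn ℝ ∞ (pd1 F) U := hF'.clm_apply contDiffOn_const
  have h2 : ContDiffOn ℝ ∞ (pd2 F) U := hF'.clm_apply contDiffOn_const
  exact h2.sub ((hf.pd1.pd2.contDiffOn.div hf.pd1.pd1.contDiffOn h.ne_zero).mul h1)

theorem contDiffOn_iterate (h : PartialLegendre f X U V) (hf : ContDiff ℝ ∞ f) (j : ℕ) :
    ContDiffOn ℝ ∞ ((levelDeriv f)^[j] fun z => -pd2 f z) U := by
  induction j with
  | zero => exact hf.pd2.neg.contDiffOn
  | succ j ih =>
    rw [Function.iterate_succ_apply']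
    exact h.contDiffOn_levelDeriv hf ih

theorem pd2_iterate_legendreFun (h : PartialLegendre f X U V) (hf : ContDiff ℝ ∞ f) (j : ℕ) :
    ∀ z ∈ V, (pd2^[j + 1] (legendreFun f X)) z =
      ((levelDeriv f)^[j] fun z => -pd2 f z) (X z, z.2) := by
  induction j with
  | zero => exact fun z hz => h.pd2_legendreFun hf hz
  | succ j ih =>
    intro z hz
    rw [Function.iterate_succ_apply' pd2 (j + 1), Function.iterate_succ_apply' (levelDeriv f) j]
    have he : pd2^[j + 1] (legendreFun f X) =ᶠ[nhds z]
        fun z => ((levelDeriv f)^[j] fun z => -pd2 f z) (X z, z.2) := by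
      filter_upwards [h.isOpen_V.mem_nhds hz] with w hw using ih w hw
    have hd : DifferentiableAt ℝ ((levelDeriv f)^[j] fun z => -pd2 f z) (X z, z.2) :=
      ((h.contDiffOn_iterate hf j).contDiffAt
        (h.isOpen_U.mem_nhds (h.mem_U z hz))).differentiableAt (by simp)
    rw [he.pd2_eq, pd2_comp hd (h.contDiff.differentiableAt_infty z), h.pd2_eq hf hz, levelDeriv]
    ring

end PartialLegendre

/-- Local uniform decay, at rate `t ^ (-3/4)`, of oscillatory integrals with phase
`t * (v · z - f z)`. -/
def LocalDecay (f : ℝ × ℝ → ℝ) (p : ℝ × ℝ) : Prop :=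
  ∃ U : Set (ℝ × ℝ), IsOpen U ∧ p ∈ U ∧ ∀ a : ℝ × ℝ → ℝ, ContDiff ℝ ∞ a → HasCompactSupport a →
    tsupport a ⊆ U → ∃ C : ℝ, ∀ v₁ v₂ t : ℝ, 1 ≤ t →
      ‖∫ z : ℝ × ℝ, Complex.exp (Complex.I * ((t * (v₁ * z.1 + v₂ * z.2 - f z) : ℝ) : ℂ)) *
        (a z : ℂ)‖ ≤ C * t ^ (-(3 : ℝ) / 4)

theorem exists_box_subset {S : Set (ℝ × ℝ)} {q : ℝ × ℝ} (hS : S ∈ nhds q) :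
    ∃ δ > 0, Set.Icc (q.1 - δ) (q.1 + δ) ×ˢ Set.Icc (q.2 - δ) (q.2 + δ) ⊆ S := by
  obtain ⟨δ, hδ, h⟩ := Metric.nhds_basis_closedBall.mem_iff.1 hS
  refine ⟨δ, hδ, ?_⟩
  rwa [← Real.closedBall_eq_Icc, ← Real.closedBall_eq_Icc, closedBall_prod_same]

namespace PartialLegendre

variable {f X : ℝ × ℝ → ℝ} {U V : Set (ℝ × ℝ)}

theorem integral_eq (h : PartialLegendre f X U V) {Q : Set (ℝ × ℝ)}
    (hQ : IsOpen Q) (hQV : Q ⊆ V) {s : ℝ} (hs : ∀ z ∈ Q, |pd1 X z| = s * pd1 X z)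
    {a : ℝ × ℝ → ℝ} (ha : ∀ z, z ∉ U ∩ (fun z => (pd1 f z, z.2)) ⁻¹' Q → a z = 0)
    (t v₁ v₂ : ℝ) :
    ∫ z : ℝ × ℝ, Complex.exp (Complex.I * ((t * (v₁ * z.1 + v₂ * z.2 - f z) : ℝ) : ℂ)) *
        (a z : ℂ) =
      ∫ z : ℝ × ℝ, Complex.exp (Complex.I * (modelPhase (legendreFun f X) X t v₁ v₂ z : ℂ)) *
        ((Q.indicator (fun z => s * a (X z, z.2)) z * pd1 X z : ℝ) : ℂ) := by
  have himg : (fun z : ℝ × ℝ => (X z, z.2)) '' Q = U ∩ (fun z => (pd1 f z, z.2)) ⁻¹' Q := by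
    ext z
    constructor
    · rintro ⟨w, hw, rfl⟩
      refine ⟨h.mem_U w (hQV hw), ?_⟩
      simpa only [Set.mem_preimage, h.pd1_eq w (hQV hw)] using hw
    · rintro ⟨hz, hz'⟩
      exact ⟨_, hz', by simp only [h.left_inv z hz]⟩
  have hinj : Set.InjOn (fun z : ℝ × ℝ => (X z, z.2)) Q := by
    intro z hz w hw hzw
    have h1 := h.pd1_eq z (hQV hz)
    have h2 := h.pd1_eq w (hQV hw)
    simp only at hzw
    rw [hzw, h2] at h1
    exact Prod.ext h1.symm (Prod.ext_iff.1 hzw).2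
  have hcv := integral_image_eq_integral_abs_det_fderiv_smul volume hQ.measurableSet
    (fun z _ => (hasFDerivAt_prodMk_snd (h.contDiff.differentiableAt_infty z)).hasFDerivWithinAt)
    hinj fun z : ℝ × ℝ =>
      Complex.exp (Complex.I * ((t * (v₁ * z.1 + v₂ * z.2 - f z) : ℝ) : ℂ)) * (a z : ℂ)
  rw [himg, setIntegral_eq_integral_of_forall_compl_eq_zero
    (fun z hz => by rw [ha z hz]; simp)] at hcv
  rw [hcv, ← integral_indicator hQ.measurableSet]
  congr 1
  ext z
  by_cases hz : z ∈ Q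
  · simp only [Set.indicator_of_mem hz, det_shearCLM, hs z hz]
    have e1 : modelPhase (legendreFun f X) X t v₁ v₂ z =
        t * (v₁ * X z + v₂ * z.2 - f (X z, z.2)) := by
      simp only [modelPhase, legendreFun]; ring
    rw [e1, Complex.real_smul]
    push_cast
    ring
  · simp [Set.indicator_of_notMem hz]

theorem contDiff_indicator (h : PartialLegendre f X U V) (hf : ContDiff ℝ ∞ f) {Q : Set (ℝ × ℝ)}
    (hQ : IsOpen Q) (hQV : Q ⊆ V) (s : ℝ) {a : ℝ × ℝ → ℝ} (ha : ContDiff ℝ ∞ a)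
    (hac : HasCompactSupport a)
    (has : tsupport a ⊆ U ∩ (fun z => (pd1 f z, z.2)) ⁻¹' Q) :
    ContDiff ℝ ∞ (Q.indicator fun z => s * a (X z, z.2)) ∧
      tsupport (Q.indicator fun z => s * a (X z, z.2)) ⊆ Q := by
  set T : ℝ × ℝ → ℝ × ℝ := fun z => (pd1 f z, z.2) with hT
  have hTc : Continuous T := (hf.pd1.prodMk contDiff_snd).continuous
  set K := T '' tsupport a with hK
  have hKc : IsCompact K := hac.isCompact.image hTc
  have hKQ : K ⊆ Q := by
    rintro _ ⟨z, hz, rfl⟩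
    exact (has hz).2
  have hsupp : ∀ z, z ∉ K → Q.indicator (fun z => s * a (X z, z.2)) z = 0 := fun z hz => by
    by_cases hzQ : z ∈ Q
    · rw [Set.indicator_of_mem hzQ]
      have : (X z, z.2) ∉ tsupport a := fun hm => hz ⟨_, hm, by
        simp only [hT, h.pd1_eq z (hQV hzQ)]⟩
      rw [image_eq_zero_of_notMem_tsupport this, mul_zero]
    · exact Set.indicator_of_notMem hzQ _
  refine ⟨?_, ?_⟩
  · rw [contDiff_iff_contDiffAt]
    intro z
    by_cases hz : z ∈ Q
    · have hg : ContDiff ℝ ∞ fun z : ℝ × ℝ => s * a (X z, z.2) :=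
        contDiff_const.mul (ha.comp (h.contDiff.prodMk contDiff_snd))
      refine hg.contDiffAt.congr_of_eventuallyEq ?_
      filter_upwards [hQ.mem_nhds hz] with w hw using Set.indicator_of_mem hw _
    · refine (contDiffAt_const (c := (0 : ℝ))).congr_of_eventuallyEq ?_
      filter_upwards [hKc.isClosed.isOpen_compl.mem_nhds fun hz' => hz (hKQ hz')] with w hw
        using hsupp w hw
  · refine (closure_minimal (fun z hz => ?_) hKc.isClosed).trans hKQ
    by_contra hz'
    exact hz (hsupp z hz')

end PartialLegendre

theorem localDecay_of_iterate_ne_zero {f : ℝ × ℝ → ℝ} (hf : ContDiff ℝ ∞ f) {p : ℝ × ℝ}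
    (hp : pd1 (pd1 f) p ≠ 0) {j : ℕ} (hj : 1 ≤ j) (hj3 : j ≤ 3)
    (hne : ((levelDeriv f)^[j] fun z => -pd2 f z) p ≠ 0) : LocalDecay f p := by
  obtain ⟨X, U, V, hpU, h⟩ := exists_partialLegendre hf hp
  set L := legendreFun f X with hLdef
  have hL : ContDiff ℝ ∞ L := contDiff_legendreFun hf h.contDiff
  set T : ℝ × ℝ → ℝ × ℝ := fun z => (pd1 f z, z.2) with hT
  have hTc : Continuous T := (hf.pd1.prodMk contDiff_snd).continuous
  set q := T p with hq
  have hqV : q ∈ V := h.mem_V p hpU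
  have hXq : (X q, q.2) = p := by
    rw [hq, h.left_inv p hpU]
  have hLq : (pd2^[j + 1] L) q ≠ 0 := by
    rw [h.pd2_iterate_legendreFun hf j q hqV, hXq]; exact hne
  have hXq0 : pd1 X q ≠ 0 := fun h0 => by
    have := h.pd1_mul hf hqV
    rw [h0] at this
    simp at this
  obtain ⟨hLc, hLi⟩ : ContDiff ℝ ∞ (pd2^[j + 1] L) ∧ _ :=
    ⟨(iteratedDeriv_eq_pd2_iterate hL 0 (j + 1)).1,
      fun p => (iteratedDeriv_eq_pd2_iterate hL p (j + 1)).2⟩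
  obtain ⟨hXc, hXi⟩ : ContDiff ℝ ∞ (pd2^[j + 1] X) ∧ _ :=
    ⟨(iteratedDeriv_eq_pd2_iterate h.contDiff 0 (j + 1)).1,
      fun p => (iteratedDeriv_eq_pd2_iterate h.contDiff p (j + 1)).2⟩
  set c := |(pd2^[j + 1] L) q| / 3 with hc
  have hc0 : 0 < c := by have := abs_pos.2 hLq; positivity
  set M := |(pd2^[j + 1] X) q| + 1 with hM
  have hM0 : 0 < M := by positivity
  have hS : {z | z ∈ V ∧ 2 * c < |(pd2^[j + 1] L) z| ∧ |(pd2^[j + 1] X) z| < M ∧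
      0 < pd1 X q * pd1 X z} ∈ nhds q := by
    refine Filter.inter_mem (h.isOpen_V.mem_nhds hqV) (Filter.inter_mem ?_ (Filter.inter_mem ?_ ?_))
    · refine (isOpen_lt continuous_const hLc.continuous.abs).mem_nhds ?_
      simp only [Set.mem_ofPred_eq]
      linarith
    · refine (isOpen_lt hXc.continuous.abs continuous_const).mem_nhds ?_
      simp only [Set.mem_ofPred_eq]
      linarith
    · refine (isOpen_lt continuous_const
        (continuous_const.mul h.contDiff.pd1.continuous)).mem_nhds ?_
      exact mul_self_pos.2 hXq0
  obtain ⟨δ, hδ, hbox⟩ := exists_box_subset hS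
  set Q := Set.Ioo (q.1 - δ) (q.1 + δ) ×ˢ Set.Ioo (q.2 - δ) (q.2 + δ) with hQ
  have hQo : IsOpen Q := isOpen_Ioo.prod isOpen_Ioo
  have hQbox : Q ⊆ Set.Icc (q.1 - δ) (q.1 + δ) ×ˢ Set.Icc (q.2 - δ) (q.2 + δ) :=
    Set.prod_mono Set.Ioo_subset_Icc_self Set.Ioo_subset_Icc_self
  have hQV : Q ⊆ V := fun z hz => (hbox (hQbox hz)).1
  obtain ⟨s, hs⟩ : ∃ s : ℝ, ∀ z ∈ Q, |pd1 X z| = s * pd1 X z := by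
    refine ⟨SignType.sign (pd1 X q), fun z hz => ?_⟩
    have hz' := (hbox (hQbox hz)).2.2.2
    rcases lt_or_gt_of_ne hXq0 with h0 | h0
    · rw [abs_of_neg (by nlinarith), sign_neg h0]; simp
    · rw [abs_of_pos (by nlinarith), sign_pos h0]; simp
  refine ⟨U ∩ T ⁻¹' Q, h.isOpen_U.inter (hQo.preimage hTc), ⟨hpU, ?_, ?_⟩, fun a ha hac has => ?_⟩
  · constructor <;> linarith
  · constructor <;> linarith
  obtain ⟨hβ, hβs⟩ := h.contDiff_indicator hf hQo hQV s ha hac has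
  obtain ⟨C, -, hC⟩ := exists_model_bound (k := j + 1) (c := c) (c₀ := c / M) hL h.contDiff hβ
    (by linarith) (by linarith) hβs (fun z hz => h.pd1_legendreFun hf (hQV (hβs hz)))
    (by omega) (by omega) hc0 (by positivity) (fun x hx y hy v₁ hv => by
      rw [hLi, hXi]
      obtain ⟨-, h1, h2, -⟩ := hbox (Set.mk_mem_prod hx hy)
      have h3 : |(x - v₁) * (pd2^[j + 1] X) (x, y)| ≤ c := by
        rw [abs_mul]
        calc _ ≤ c / M * M := by gcongr
          _ = c := by field_simp
      have h4 := abs_sub_abs_le_abs_sub ((pd2^[j + 1] L) (x, y))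
        ((x - v₁) * (pd2^[j + 1] X) (x, y))
      linarith)
  refine ⟨C, fun v₁ v₂ t ht => ?_⟩
  rw [h.integral_eq hQo hQV hs
    (fun z hz => image_eq_zero_of_notMem_tsupport fun h' => hz (has h'))]
  exact hC t v₁ v₂ ht

theorem LocalDecay.of_comp {f : ℝ × ℝ → ℝ} {p : ℝ × ℝ} (e : (ℝ × ℝ) ≃L[ℝ] ℝ × ℝ)
    (he : MeasurePreserving e) (h : LocalDecay (f ∘ e) p) : LocalDecay f (e p) := by
  obtain ⟨U, hU, hp, h⟩ := h
  refine ⟨e.symm ⁻¹' U, hU.preimage e.symm.continuous, by simpa using hp, fun a ha hac has => ?_⟩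
  have hts : tsupport (a ∘ e) ⊆ U := by
    refine (closure_minimal (t := e ⁻¹' tsupport a) (fun z hz => subset_tsupport a hz)
      ((isClosed_tsupport a).preimage e.continuous)).trans fun z hz => ?_
    simpa using has hz
  obtain ⟨C, hC⟩ := h (a ∘ e) (ha.comp e.contDiff)
    (hac.comp_isClosedEmbedding e.toHomeomorph.isClosedEmbedding) hts
  refine ⟨C, fun v₁ v₂ t ht => ?_⟩
  have hb := hC (v₁ * (e (1, 0)).1 + v₂ * (e (1, 0)).2) (v₁ * (e (0, 1)).1 + v₂ * (e (0, 1)).2) t ht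
  rw [← he.integral_comp e.toHomeomorph.measurableEmbedding]
  refine le_of_eq_of_le ?_ hb
  congr 2
  ext z
  have hz : e z = z.1 • e (1, 0) + z.2 • e (0, 1) := by
    rw [← map_smul, ← map_smul, ← map_add]; simp
  have h1 : (e z).1 = z.1 * (e (1, 0)).1 + z.2 * (e (0, 1)).1 := by
    conv_lhs => rw [hz]
    rfl
  have h2 : (e z).2 = z.1 * (e (1, 0)).2 + z.2 * (e (0, 1)).2 := by
    conv_lhs => rw [hz]
    rfl
  simp only [Function.comp_apply]
  congr 5
  rw [h1, h2]
  ring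

/-- The linear map `(x, y) ↦ (x, x + y)`. -/
def addFstEquiv : (ℝ × ℝ) ≃L[ℝ] ℝ × ℝ :=
  ContinuousLinearEquiv.equivOfInverse
    ((ContinuousLinearMap.fst ℝ ℝ ℝ).prod
      (ContinuousLinearMap.fst ℝ ℝ ℝ + ContinuousLinearMap.snd ℝ ℝ ℝ))
    ((ContinuousLinearMap.fst ℝ ℝ ℝ).prod
      (ContinuousLinearMap.snd ℝ ℝ ℝ - ContinuousLinearMap.fst ℝ ℝ ℝ))
    (fun v => by ext <;> simp) (fun v => by ext <;> simp)

theorem addFstEquiv_apply (z : ℝ × ℝ) : addFstEquiv z = (z.1, z.1 + z.2) := rfl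

theorem LocalDecay.of_swap {f : ℝ × ℝ → ℝ} (hf : ∀ z, f z.swap = f z) {p : ℝ × ℝ}
    (h : LocalDecay f p.swap) : LocalDecay f p := by
  have e1 : f ∘ (ContinuousLinearEquiv.prodComm ℝ ℝ ℝ) = f := funext hf
  have := LocalDecay.of_comp (f := f) (p := p.swap) (ContinuousLinearEquiv.prodComm ℝ ℝ ℝ)
    Measure.measurePreserving_swap (by rwa [e1])
  simpa using this

theorem pd1_comp_addFstEquiv {F : ℝ × ℝ → ℝ} (hF : ContDiff ℝ ∞ F) :
    pd1 (F ∘ addFstEquiv) = fun z => pd1 F (addFstEquiv z) + pd2 F (addFstEquiv z) := by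
  ext z
  have h := (hF.differentiableAt_infty (addFstEquiv z)).hasFDerivAt.comp z
    addFstEquiv.hasFDerivAt
  rw [pd1, h.fderiv, ContinuousLinearMap.comp_apply, fderiv_prod_apply]
  simp [addFstEquiv_apply]

theorem pd2_comp_addFstEquiv {F : ℝ × ℝ → ℝ} (hF : ContDiff ℝ ∞ F) :
    pd2 (F ∘ addFstEquiv) = fun z => pd2 F (addFstEquiv z) := by
  ext z
  have h := (hF.differentiableAt_infty (addFstEquiv z)).hasFDerivAt.comp z
    addFstEquiv.hasFDerivAt
  rw [pd2, h.fderiv, ContinuousLinearMap.comp_apply, fderiv_prod_apply]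
  simp [addFstEquiv_apply]

theorem pd1_add {F G : ℝ × ℝ → ℝ} {z : ℝ × ℝ} (hF : DifferentiableAt ℝ F z)
    (hG : DifferentiableAt ℝ G z) : pd1 (fun z => F z + G z) z = pd1 F z + pd1 G z := by
  simp only [pd1]
  rw [fderiv_fun_add hF hG]; rfl

theorem pd2_add {F G : ℝ × ℝ → ℝ} {z : ℝ × ℝ} (hF : DifferentiableAt ℝ F z)
    (hG : DifferentiableAt ℝ G z) : pd2 (fun z => F z + G z) z = pd2 F z + pd2 G z := by
  simp only [pd2]
  rw [fderiv_fun_add hF hG]; rfl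

theorem levelDeriv_neg_pd2 (f : ℝ × ℝ → ℝ) (z : ℝ × ℝ) :
    levelDeriv f (fun z => -pd2 f z) z =
      -pd2 (pd2 f) z + pd2 (pd1 f) z / pd1 (pd1 f) z * pd1 (pd2 f) z := by
  simp only [levelDeriv]
  have h1 : pd2 (fun z => -pd2 f z) z = -pd2 (pd2 f) z := by
    unfold pd2; rw [fderiv_fun_neg]; rfl
  have h2 : pd1 (fun z => -pd2 f z) z = -pd1 (pd2 f) z := by
    unfold pd1; rw [fderiv_fun_neg]; rfl
  rw [h1, h2]; ring

/-- If both pure second derivatives vanish but the mixed one does not, a shear makes the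
Hessian criterion applicable. -/
theorem localDecay_of_mixed_ne_zero {f : ℝ × ℝ → ℝ} (hf : ContDiff ℝ ∞ f) {p : ℝ × ℝ}
    (h11 : pd1 (pd1 f) p = 0) (h22 : pd2 (pd2 f) p = 0)
    (hsymm : pd1 (pd2 f) p = pd2 (pd1 f) p) (h12 : pd2 (pd1 f) p ≠ 0) : LocalDecay f p := by
  set e := addFstEquiv with he
  obtain ⟨p', rfl⟩ : ∃ p', e p' = p := ⟨e.symm p, by simp⟩
  refine LocalDecay.of_comp e ?_ ?_
  · exact measurePreserving_prod_add (μ := (volume : Measure ℝ)) (ν := (volume : Measure ℝ))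
  have d1 := hf.pd1.differentiableAt_infty
  have hfe : ContDiff ℝ ∞ (f ∘ e) := hf.comp e.contDiff
  have c1 : ContDiff ℝ ∞ fun z => pd1 f z + pd2 f z := hf.pd1.add hf.pd2
  have f1 : pd1 (f ∘ e) = (fun z => pd1 f z + pd2 f z) ∘ e := pd1_comp_addFstEquiv hf
  have f2 : pd2 (f ∘ e) = pd2 f ∘ e := pd2_comp_addFstEquiv hf
  have a11 : pd1 (pd1 (f ∘ e)) p' = 2 * pd2 (pd1 f) (e p') := by
    rw [f1, pd1_comp_addFstEquiv c1]
    simp only []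
    rw [pd1_add (hf.pd1.differentiableAt_infty _) (hf.pd2.differentiableAt_infty _),
      pd2_add (hf.pd1.differentiableAt_infty _) (hf.pd2.differentiableAt_infty _)]
    rw [h11, h22, hsymm]; ring
  have a12 : pd2 (pd1 (f ∘ e)) p' = pd2 (pd1 f) (e p') := by
    rw [f1, pd2_comp_addFstEquiv c1]
    simp only []
    rw [pd2_add (hf.pd1.differentiableAt_infty _) (hf.pd2.differentiableAt_infty _), h22, add_zero]
  have a21 : pd1 (pd2 (f ∘ e)) p' = pd2 (pd1 f) (e p') := by
    rw [f2, pd1_comp_addFstEquiv hf.pd2]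
    simp only []
    rw [h22, hsymm, add_zero]
  have a22 : pd2 (pd2 (f ∘ e)) p' = 0 := by
    rw [f2, pd2_comp_addFstEquiv hf.pd2]
    exact h22
  refine localDecay_of_iterate_ne_zero hfe (j := 1) (by rw [a11]; positivity) le_rfl
    (by norm_num) ?_
  rw [Function.iterate_one, levelDeriv_neg_pd2, a11, a12, a21, a22]
  field_simp
  simpa using h12

theorem levelDeriv_mul {f F G : ℝ × ℝ → ℝ} {z : ℝ × ℝ} (hF : DifferentiableAt ℝ F z)
    (hG : DifferentiableAt ℝ G z) : levelDeriv f (fun z => F z * G z) z =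
      levelDeriv f F z * G z + F z * levelDeriv f G z := by
  simp only [levelDeriv, pd1, pd2]
  rw [fderiv_fun_mul hF hG]
  simp only [add_apply, smul_apply, smul_eq_mul]
  ring

theorem levelDeriv_add {f F G : ℝ × ℝ → ℝ} {z : ℝ × ℝ} (hF : DifferentiableAt ℝ F z)
    (hG : DifferentiableAt ℝ G z) : levelDeriv f (fun z => F z + G z) z =
      levelDeriv f F z + levelDeriv f G z := by
  simp only [levelDeriv]
  rw [pd1_add hF hG, pd2_add hF hG]
  ring

theorem Filter.EventuallyEq.levelDeriv {f F G : ℝ × ℝ → ℝ} {z : ℝ × ℝ} (h : F =ᶠ[nhds z] G) :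
    levelDeriv f F =ᶠ[nhds z] levelDeriv f G := by
  filter_upwards [h.eventuallyEq_nhds] with w hw
  unfold _root_.levelDeriv
  rw [hw.pd1_eq, hw.pd2_eq]

theorem pd1_eq_of_hasDerivAt {F : ℝ × ℝ → ℝ} {z : ℝ × ℝ} {d : ℝ} (hF : DifferentiableAt ℝ F z)
    (h : HasDerivAt (fun x => F (x, z.2)) d z.1) : pd1 F z = d :=
  (hasDerivAt_pd1 (x := z.1) (y := z.2) hF).unique h

theorem pd2_eq_of_hasDerivAt {F : ℝ × ℝ → ℝ} {z : ℝ × ℝ} {d : ℝ} (hF : DifferentiableAt ℝ F z)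
    (h : HasDerivAt (fun y => F (z.1, y)) d z.2) : pd2 F z = d :=
  (hasDerivAt_pd2 (x := z.1) (y := z.2) hF).unique h

/-- The square of the two-dimensional dispersion relation. -/
def kgSq (z : ℝ × ℝ) : ℝ := 5 - 2 * cos z.1 - 2 * cos z.2

/-- The two-dimensional dispersion relation. -/
def kgOmega (z : ℝ × ℝ) : ℝ := √(kgSq z)

theorem contDiff_kgSq : ContDiff ℝ ∞ kgSq := by
  unfold kgSq
  have h1 : ContDiff ℝ ∞ fun z : ℝ × ℝ => cos z.1 := Real.contDiff_cos.comp contDiff_fst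
  have h2 : ContDiff ℝ ∞ fun z : ℝ × ℝ => cos z.2 := Real.contDiff_cos.comp contDiff_snd
  fun_prop

theorem one_le_kgSq (z : ℝ × ℝ) : 1 ≤ kgSq z := by
  unfold kgSq
  linarith [cos_le_one z.1, cos_le_one z.2]

theorem kgSq_pos (z : ℝ × ℝ) : 0 < kgSq z := one_pos.trans_le (one_le_kgSq z)

theorem kgOmega_pos (z : ℝ × ℝ) : 0 < kgOmega z := Real.sqrt_pos.2 (kgSq_pos z)

theorem kgOmega_sq (z : ℝ × ℝ) : kgOmega z ^ 2 = kgSq z := Real.sq_sqrt (kgSq_pos z).le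

theorem contDiff_kgOmega : ContDiff ℝ ∞ kgOmega :=
  contDiff_kgSq.sqrt fun z => (kgSq_pos z).ne'

theorem kgOmega_swap (z : ℝ × ℝ) : kgOmega z.swap = kgOmega z := by
  simp only [kgOmega, kgSq, Prod.fst_swap, Prod.snd_swap]
  congr 1; ring

theorem hasDerivAt_kgOmega_fst (x y : ℝ) :
    HasDerivAt (fun x => kgOmega (x, y)) (sin x / kgOmega (x, y)) x := by
  have h : HasDerivAt (fun x => kgSq (x, y)) (2 * sin x) x :=
    ((((hasDerivAt_cos x).const_mul 2).const_sub 5).sub_const (2 * cos y)).congr_deriv (by ring)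
  refine (h.sqrt (kgSq_pos _).ne').congr_deriv ?_
  rw [kgOmega]
  have := (Real.sqrt_pos.2 (kgSq_pos (x, y))).ne'
  field_simp

theorem hasDerivAt_kgOmega_snd (x y : ℝ) :
    HasDerivAt (fun y => kgOmega (x, y)) (sin y / kgOmega (x, y)) y := by
  have h : HasDerivAt (fun y => kgSq (x, y)) (2 * sin y) y :=
    ((((hasDerivAt_cos y).const_mul 2).const_sub (5 - 2 * cos x))).congr_deriv (by ring)
  refine (h.sqrt (kgSq_pos _).ne').congr_deriv ?_
  rw [kgOmega]
  have := (Real.sqrt_pos.2 (kgSq_pos (x, y))).ne'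
  field_simp

theorem pd1_kgOmega : pd1 kgOmega = fun z => sin z.1 / kgOmega z := by
  ext z
  exact pd1_eq_of_hasDerivAt (contDiff_kgOmega.differentiableAt_infty z)
    (hasDerivAt_kgOmega_fst z.1 z.2)

theorem pd2_kgOmega : pd2 kgOmega = fun z => sin z.2 / kgOmega z := by
  ext z
  exact pd2_eq_of_hasDerivAt (contDiff_kgOmega.differentiableAt_infty z)
    (hasDerivAt_kgOmega_snd z.1 z.2)

/-- The numerator of `∂₁² ω`. -/
def kgA (z : ℝ × ℝ) : ℝ := cos z.1 * kgSq z - sin z.1 ^ 2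

/-- The numerator of `∂₂² ω`. -/
def kgA' (z : ℝ × ℝ) : ℝ := cos z.2 * kgSq z - sin z.2 ^ 2

/-- The numerator of the Hessian determinant of `ω`. -/
def kgDet (z : ℝ × ℝ) : ℝ :=
  5 * cos z.1 * cos z.2 - cos z.1 - cos z.2 - cos z.1 * cos z.2 * (cos z.1 + cos z.2)

theorem pd1_pd1_kgOmega : pd1 (pd1 kgOmega) = fun z => kgA z / kgOmega z ^ 3 := by
  ext z
  refine pd1_eq_of_hasDerivAt (contDiff_kgOmega.pd1.differentiableAt_infty z) ?_
  rw [pd1_kgOmega]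
  have h0 := (kgOmega_pos z).ne'
  refine ((hasDerivAt_sin z.1).div (hasDerivAt_kgOmega_fst z.1 z.2) h0).congr_deriv ?_
  rw [kgA, ← kgOmega_sq]
  field_simp

theorem pd2_pd1_kgOmega :
    pd2 (pd1 kgOmega) = fun z => -(sin z.1 * sin z.2) / kgOmega z ^ 3 := by
  ext z
  refine pd2_eq_of_hasDerivAt (contDiff_kgOmega.pd1.differentiableAt_infty z) ?_
  rw [pd1_kgOmega]
  have h0 := (kgOmega_pos z).ne'
  refine ((hasDerivAt_const z.2 (sin z.1)).div (hasDerivAt_kgOmega_snd z.1 z.2) h0).congr_deriv ?_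
  field_simp
  ring

theorem pd1_pd2_kgOmega :
    pd1 (pd2 kgOmega) = fun z => -(sin z.1 * sin z.2) / kgOmega z ^ 3 := by
  ext z
  refine pd1_eq_of_hasDerivAt (contDiff_kgOmega.pd2.differentiableAt_infty z) ?_
  rw [pd2_kgOmega]
  have h0 := (kgOmega_pos z).ne'
  refine ((hasDerivAt_const z.1 (sin z.2)).div (hasDerivAt_kgOmega_fst z.1 z.2) h0).congr_deriv ?_
  field_simp
  ring

theorem pd2_pd2_kgOmega : pd2 (pd2 kgOmega) = fun z => kgA' z / kgOmega z ^ 3 := by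
  ext z
  refine pd2_eq_of_hasDerivAt (contDiff_kgOmega.pd2.differentiableAt_infty z) ?_
  rw [pd2_kgOmega]
  have h0 := (kgOmega_pos z).ne'
  refine ((hasDerivAt_sin z.2).div (hasDerivAt_kgOmega_snd z.1 z.2) h0).congr_deriv ?_
  rw [kgA', ← kgOmega_sq]
  field_simp

theorem kgA_mul_kgA' (z : ℝ × ℝ) :
    kgA z * kgA' z - sin z.1 ^ 2 * sin z.2 ^ 2 = kgSq z * kgDet z := by
  simp only [kgA, kgA', kgDet, kgSq, sin_sq]
  ring

theorem levelDeriv_kgOmega {F : ℝ × ℝ → ℝ} {z : ℝ × ℝ} :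
    levelDeriv kgOmega F z = pd2 F z + sin z.1 * sin z.2 / kgA z * pd1 F z := by
  rw [levelDeriv, pd2_pd1_kgOmega, pd1_pd1_kgOmega]
  have h0 := (kgOmega_pos z).ne'
  have : -(sin z.1 * sin z.2) / kgOmega z ^ 3 / (kgA z / kgOmega z ^ 3)
      = -(sin z.1 * sin z.2 / kgA z) := by
    rw [div_div_div_cancel_right₀ (by positivity)]; ring
  simp only [this]
  ring

theorem levelDeriv_neg_pd2_kgOmega {z : ℝ × ℝ} (hz : kgA z ≠ 0) :
    levelDeriv kgOmega (fun z => -pd2 kgOmega z) z = -(kgOmega z * kgA z)⁻¹ * kgDet z := by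
  rw [levelDeriv_neg_pd2, pd2_pd2_kgOmega, pd2_pd1_kgOmega, pd1_pd1_kgOmega, pd1_pd2_kgOmega]
  have h0 := (kgOmega_pos z).ne'
  have h1 := kgA_mul_kgA' z
  rw [← kgOmega_sq] at h1
  simp only []
  field_simp
  linear_combination -h1

theorem contDiff_kgA : ContDiff ℝ ∞ kgA := by
  have h1 : ContDiff ℝ ∞ fun z : ℝ × ℝ => cos z.1 := Real.contDiff_cos.comp contDiff_fst
  have h2 : ContDiff ℝ ∞ fun z : ℝ × ℝ => sin z.1 := Real.contDiff_sin.comp contDiff_fst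
  exact (h1.mul contDiff_kgSq).sub (h2.pow 2)

theorem contDiff_kgA' : ContDiff ℝ ∞ kgA' := by
  have h1 : ContDiff ℝ ∞ fun z : ℝ × ℝ => cos z.2 := Real.contDiff_cos.comp contDiff_snd
  have h2 : ContDiff ℝ ∞ fun z : ℝ × ℝ => sin z.2 := Real.contDiff_sin.comp contDiff_snd
  exact (h1.mul contDiff_kgSq).sub (h2.pow 2)

theorem contDiff_kgDet : ContDiff ℝ ∞ kgDet := by
  unfold kgDet
  have h1 : ContDiff ℝ ∞ fun z : ℝ × ℝ => cos z.1 := Real.contDiff_cos.comp contDiff_fst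
  have h2 : ContDiff ℝ ∞ fun z : ℝ × ℝ => cos z.2 := Real.contDiff_cos.comp contDiff_snd
  fun_prop

theorem pd1_kgDet (z : ℝ × ℝ) : pd1 kgDet z = -(sin z.1 * kgA' z) := by
  refine pd1_eq_of_hasDerivAt (contDiff_kgDet.differentiableAt_infty z) ?_
  have h := hasDerivAt_cos z.1
  have := ((((h.const_mul 5).mul_const (cos z.2)).sub h).sub_const (cos z.2)).sub
    ((h.mul_const (cos z.2)).mul (h.add_const (cos z.2)))
  refine this.congr_deriv ?_
  simp only [kgA', kgSq, sin_sq z.2]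
  ring

theorem pd2_kgDet (z : ℝ × ℝ) : pd2 kgDet z = -(sin z.2 * kgA z) := by
  refine pd2_eq_of_hasDerivAt (contDiff_kgDet.differentiableAt_infty z) ?_
  have h := hasDerivAt_cos z.2
  have := (((h.const_mul (5 * cos z.1)).sub_const (cos z.1)).sub h).sub
    ((h.const_mul (cos z.1)).mul (h.const_add (cos z.1)))
  refine this.congr_deriv ?_
  simp only [kgA, kgSq, sin_sq z.1]
  ring

/-- The numerator of the derivative of `kgDet` along the level curves of `∂₁ ω`. -/
def kgB (z : ℝ × ℝ) : ℝ := sin z.1 ^ 2 * kgA' z + kgA z ^ 2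

theorem contDiff_kgB : ContDiff ℝ ∞ kgB := by
  have h2 : ContDiff ℝ ∞ fun z : ℝ × ℝ => sin z.1 := Real.contDiff_sin.comp contDiff_fst
  exact ((h2.pow 2).mul contDiff_kgA').add (contDiff_kgA.pow 2)

theorem levelDeriv_kgDet {z : ℝ × ℝ} (hz : kgA z ≠ 0) :
    levelDeriv kgOmega kgDet z = -(sin z.2 / kgA z) * kgB z := by
  rw [levelDeriv_kgOmega, pd1_kgDet, pd2_kgDet, kgB]
  field_simp
  ring

theorem levelDeriv_kgB {z : ℝ × ℝ} (h1 : cos z.1 = 0) (h2 : cos z.2 = 0) :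
    levelDeriv kgOmega kgB z = -15 * sin z.2 := by
  have s1 : sin z.1 ^ 2 = 1 := by have := sin_sq_add_cos_sq z.1; rw [h1] at this; linarith
  have s2 : sin z.2 ^ 2 = 1 := by have := sin_sq_add_cos_sq z.2; rw [h2] at this; linarith
  have hA : kgA z = -1 := by simp [kgA, h1, s1]
  have hA' : kgA' z = -1 := by simp [kgA', h2, s2]
  have hq : kgSq z = 5 := by simp [kgSq, h1, h2]
  have e1 : pd1 kgB z = 10 * sin z.1 := by
    refine pd1_eq_of_hasDerivAt (contDiff_kgB.differentiableAt_infty z) ?_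
    have hc := hasDerivAt_cos z.1
    have hs := hasDerivAt_sin z.1
    have hQ : HasDerivAt (fun x => kgSq (x, z.2)) (2 * sin z.1) z.1 :=
      (((hc.const_mul 2).const_sub 5).sub_const (2 * cos z.2)).congr_deriv (by ring)
    have hA1 : HasDerivAt (fun x => kgA (x, z.2)) _ z.1 := (hc.mul hQ).sub (hs.pow 2)
    have hA2 : HasDerivAt (fun x => kgA' (x, z.2)) _ z.1 :=
      (hQ.const_mul (cos z.2)).sub_const (sin z.2 ^ 2)
    refine (((hs.pow 2).mul hA2).add (hA1.pow 2)).congr_deriv ?_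
    simp only [Pi.pow_apply, h1, h2, hA, hq, Prod.mk.eta]
    push_cast
    ring
  have e2 : pd2 kgB z = -5 * sin z.2 := by
    refine pd2_eq_of_hasDerivAt (contDiff_kgB.differentiableAt_infty z) ?_
    have hc := hasDerivAt_cos z.2
    have hs := hasDerivAt_sin z.2
    have hQ : HasDerivAt (fun y => kgSq (z.1, y)) (2 * sin z.2) z.2 :=
      ((hc.const_mul 2).const_sub (5 - 2 * cos z.1)).congr_deriv (by ring)
    have hA1 : HasDerivAt (fun y => kgA (z.1, y)) _ z.2 :=
      (hQ.const_mul (cos z.1)).sub_const (sin z.1 ^ 2)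
    have hA2 : HasDerivAt (fun y => kgA' (z.1, y)) _ z.2 := (hc.mul hQ).sub (hs.pow 2)
    refine ((hA2.const_mul (sin z.1 ^ 2)).add (hA1.pow 2)).congr_deriv ?_
    simp only [h1, h2, hA, hq, s1, Prod.mk.eta]
    push_cast
    ring
  rw [levelDeriv_kgOmega, e1, e2, hA]
  linear_combination (-10 * sin z.2) * s1

theorem false_of_cubic_balance {a b : ℝ} (ha : 0 < a) (hb : 0 < b) (ha1 : a ≤ 1) (hb1 : b ≤ 1)
    (h1 : -(5 * (a * b)) = (a - b) * (1 - a * b))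
    (h2 : a ^ 3 * (1 - b ^ 2) ^ 2 = b ^ 3 * (1 - a ^ 2) ^ 2) : False := by
  have hab : 0 < a * b := mul_pos ha hb
  have hab1 : a * b ≤ 1 := mul_le_one₀ ha1 hb.le hb1
  have hlt : a < b := by
    by_contra! h
    have := mul_nonneg (sub_nonneg.2 h) (sub_nonneg.2 hab1)
    linarith
  have h3 : a ^ 3 < b ^ 3 := pow_lt_pow_left₀ hlt ha.le (by norm_num)
  have h4 : 0 ≤ 1 - b ^ 2 := by nlinarith
  have h5 : 1 - b ^ 2 < 1 - a ^ 2 := by nlinarith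
  have h6 : (1 - b ^ 2) ^ 2 < (1 - a ^ 2) ^ 2 := pow_lt_pow_left₀ h5 h4 (by norm_num)
  have h7 : a ^ 3 * (1 - b ^ 2) ^ 2 < b ^ 3 * (1 - a ^ 2) ^ 2 :=
    mul_lt_mul'' h3 h6 (by positivity) (by positivity)
  linarith

theorem cos_eq_zero_of_kgB_eq_zero {z : ℝ × ℝ} (hz : kgA z ≠ 0) (hg : kgDet z = 0)
    (hB : kgB z = 0) : cos z.1 = 0 ∧ cos z.2 = 0 := by
  have hs1 := sin_sq_add_cos_sq z.1
  have hs2 := sin_sq_add_cos_sq z.2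
  have hAA := kgA_mul_kgA' z
  rw [hg, mul_zero] at hAA
  have r1 : kgA z * cos z.2 = kgDet z + cos z.1 * sin z.2 ^ 2 := by
    simp only [kgA, kgDet, kgSq, sin_sq]; ring
  have r2 : kgA' z * cos z.1 = kgDet z + cos z.2 * sin z.1 ^ 2 := by
    simp only [kgA', kgDet, kgSq, sin_sq]; ring
  have hg' : 5 * (cos z.1 * cos z.2) = (cos z.1 + cos z.2) * (1 + cos z.1 * cos z.2) := by
    have := hg; simp only [kgDet] at this; linear_combination this
  rw [hg, zero_add] at r1 r2
  rw [kgB] at hB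
  have b1 := neg_one_le_cos z.1
  have b2 := neg_one_le_cos z.2
  have b3 := cos_le_one z.1
  have b4 := cos_le_one z.2
  generalize cos z.1 = c at *
  generalize cos z.2 = d at *
  generalize sin z.1 = s at *
  generalize sin z.2 = r at *
  generalize kgA z = A at *
  generalize kgA' z = A' at *
  have hA2 : 0 < A ^ 2 := by positivity
  have hA'neg : A' < 0 := by
    by_contra! h
    nlinarith [mul_nonneg (sq_nonneg s) h]
  have hAneg : A < 0 := by
    refine lt_of_le_of_ne ?_ hz
    by_contra! h
    nlinarith [mul_pos h (neg_pos.2 hA'neg), mul_nonneg (sq_nonneg s) (sq_nonneg r)]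
  by_cases hd : d = 0
  · subst hd
    have : r ^ 2 = 1 := by linarith
    rw [this] at r1
    exact ⟨by linarith, rfl⟩
  by_cases hc : c = 0
  · subst hc
    have : s ^ 2 = 1 := by linarith
    rw [this] at r2
    exact ⟨rfl, by linarith⟩
  exfalso
  have key : c ^ 3 * r ^ 4 + d ^ 3 * s ^ 4 = 0 := by
    linear_combination (c * d ^ 2) * hB - (s ^ 2 * d ^ 2) * r2 - (c * (A * d + c * r ^ 2)) * r1
  have hcd : c * d < 0 := by
    have h1 : A * d ^ 2 = c * d * r ^ 2 := by linear_combination d * r1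
    have h2 : 0 < d ^ 2 := by positivity
    by_contra! h
    nlinarith [mul_nonneg h (sq_nonneg r), mul_pos (neg_pos.2 hAneg) h2]
  have hr : r ^ 2 = 1 - d ^ 2 := by linarith
  have hs : s ^ 2 = 1 - c ^ 2 := by linarith
  have key' : c ^ 3 * (1 - d ^ 2) ^ 2 = (-d) ^ 3 * (1 - c ^ 2) ^ 2 := by
    rw [← hr, ← hs]; linear_combination key
  rcases lt_or_gt_of_ne hc with h | h
  · have hd0 : 0 < d := by nlinarith
    refine false_of_cubic_balance (a := d) (b := -c) hd0 (by linarith) b4 (by linarith) ?_ ?_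
    · linear_combination hg'
    · linear_combination key'
  · have hd0 : 0 < -d := by nlinarith
    refine false_of_cubic_balance (a := c) (b := -d) h hd0 b3 (by linarith) ?_ ?_
    · linear_combination hg'
    · linear_combination key'

theorem localDecay_kgOmega_of_kgA_ne_zero {p : ℝ × ℝ} (hp : kgA p ≠ 0) :
    LocalDecay kgOmega p := by
  have h0 : pd1 (pd1 kgOmega) p ≠ 0 := by
    rw [pd1_pd1_kgOmega]
    exact div_ne_zero hp (pow_ne_zero _ (kgOmega_pos p).ne')
  set E : ℝ × ℝ → ℝ := fun z => -(kgOmega z * kgA z)⁻¹ with hE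
  have hEp : E p ≠ 0 := neg_ne_zero.2 (inv_ne_zero (mul_ne_zero (kgOmega_pos p).ne' hp))
  have hnhds : ∀ᶠ z in nhds p, kgA z ≠ 0 :=
    (isOpen_ne_fun contDiff_kgA.continuous continuous_const).mem_nhds hp
  have hH : levelDeriv kgOmega (fun z => -pd2 kgOmega z) =ᶠ[nhds p] fun z => E z * kgDet z :=
    hnhds.mono fun z hz => levelDeriv_neg_pd2_kgOmega hz
  by_cases hg : kgDet p = 0
  swap
  · refine localDecay_of_iterate_ne_zero contDiff_kgOmega h0 (j := 1) le_rfl (by norm_num) ?_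
    rw [Function.iterate_one, hH.eq_of_nhds]
    exact mul_ne_zero hEp hg
  have hdE : ∀ z, kgA z ≠ 0 → ContDiffAt ℝ ∞ E z := fun z hz =>
    ((contDiff_kgOmega.contDiffAt.mul contDiff_kgA.contDiffAt).inv
      (mul_ne_zero (kgOmega_pos z).ne' hz)).neg
  have hdg := contDiff_kgDet.differentiableAt_infty
  have hH2 : levelDeriv kgOmega (levelDeriv kgOmega fun z => -pd2 kgOmega z) =ᶠ[nhds p]
      fun z => levelDeriv kgOmega E z * kgDet z + E z * (-(sin z.2 / kgA z) * kgB z) := by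
    refine hH.levelDeriv.trans (hnhds.mono fun z hz => ?_)
    rw [levelDeriv_mul ((hdE z hz).differentiableAt (by simp)) (hdg z), levelDeriv_kgDet hz]
  have hs2 : sin p.2 ≠ 0 := fun hs => by
    have h1 := kgA_mul_kgA' p
    rw [hg, hs] at h1
    have h2 : kgA' p = 0 := by
      have : kgA p * kgA' p = 0 := by linarith
      exact (mul_eq_zero.1 this).resolve_left hp
    rw [kgA', hs] at h2
    have h3 : cos p.2 * kgSq p = 0 := by linarith
    have h4 := (mul_eq_zero.1 h3).resolve_right (kgSq_pos p).ne'
    have := sin_sq_add_cos_sq p.2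
    rw [hs, h4] at this
    norm_num at this
  by_cases hB : kgB p = 0
  swap
  · refine localDecay_of_iterate_ne_zero contDiff_kgOmega h0 (j := 2) (by norm_num) (by norm_num) ?_
    change levelDeriv kgOmega (levelDeriv kgOmega fun z => -pd2 kgOmega z) p ≠ 0
    rw [hH2.eq_of_nhds, hg, mul_zero, zero_add]
    exact mul_ne_zero hEp (mul_ne_zero (neg_ne_zero.2 (div_ne_zero hs2 hp)) hB)
  obtain ⟨hc1, hc2⟩ := cos_eq_zero_of_kgB_eq_zero hp hg hB
  refine localDecay_of_iterate_ne_zero contDiff_kgOmega h0 (j := 3) (by norm_num) le_rfl ?_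
  change levelDeriv kgOmega (levelDeriv kgOmega (levelDeriv kgOmega fun z => -pd2 kgOmega z)) p ≠ 0
  have dE : DifferentiableAt ℝ E p := (hdE p hp).differentiableAt (by simp)
  have dDE : DifferentiableAt ℝ (levelDeriv kgOmega E) p := by
    have h1 : ContDiffAt ℝ ∞ (fderiv ℝ E) p := (hdE p hp).fderiv_right (by simp)
    have h2 : ContDiffAt ℝ ∞ (pd1 E) p := h1.clm_apply contDiffAt_const
    have h3 : ContDiffAt ℝ ∞ (pd2 E) p := h1.clm_apply contDiffAt_const
    exact (h3.sub ((contDiff_kgOmega.pd1.pd2.contDiffAt.div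
      contDiff_kgOmega.pd1.pd1.contDiffAt h0).mul h2)).differentiableAt (by simp)
  have dB := contDiff_kgB.differentiableAt_infty p
  have dq : DifferentiableAt ℝ (fun z : ℝ × ℝ => -(sin z.2 / kgA z)) p := by
    have h1 : ContDiffAt ℝ ∞ (fun z : ℝ × ℝ => sin z.2) p :=
      (Real.contDiff_sin.comp contDiff_snd).contDiffAt
    exact ((h1.div contDiff_kgA.contDiffAt hp).differentiableAt (by simp)).neg
  rw [hH2.levelDeriv.eq_of_nhds,
    levelDeriv_add (F := fun z => levelDeriv kgOmega E z * kgDet z)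
      (G := fun z => E z * (-(sin z.2 / kgA z) * kgB z)) (dDE.mul (hdg p)) (dE.mul (dq.mul dB)),
    levelDeriv_mul dDE (hdg p),
    levelDeriv_mul (G := fun z => -(sin z.2 / kgA z) * kgB z) dE (dq.mul dB),
    levelDeriv_mul (F := fun z => -(sin z.2 / kgA z)) dq dB,
    levelDeriv_kgDet hp, hg, hB, levelDeriv_kgB hc1 hc2]
  simp only [mul_zero, zero_add, add_zero]
  exact mul_ne_zero hEp (mul_ne_zero (neg_ne_zero.2 (div_ne_zero hs2 hp))
    (mul_ne_zero (by norm_num) hs2))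

theorem localDecay_kgOmega (p : ℝ × ℝ) : LocalDecay kgOmega p := by
  by_cases h1 : kgA p = 0
  swap
  · exact localDecay_kgOmega_of_kgA_ne_zero h1
  by_cases h2 : kgA' p = 0
  swap
  · refine LocalDecay.of_swap kgOmega_swap (localDecay_kgOmega_of_kgA_ne_zero ?_)
    convert h2 using 1
    simp only [kgA, kgA', kgSq, Prod.fst_swap, Prod.snd_swap]
    ring
  have hne : ∀ c s : ℝ, c * kgSq p - s ^ 2 = 0 → s ^ 2 + c ^ 2 = 1 → s ≠ 0 := by
    rintro c s hc hs rfl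
    have h3 : c * kgSq p = 0 := by linarith
    rw [(mul_eq_zero.1 h3).resolve_right (kgSq_pos p).ne'] at hs
    norm_num at hs
  refine localDecay_of_mixed_ne_zero contDiff_kgOmega ?_ ?_ ?_ ?_
  · simp [pd1_pd1_kgOmega, h1]
  · simp [pd2_pd2_kgOmega, h2]
  · rw [pd1_pd2_kgOmega, pd2_pd1_kgOmega]
  · rw [pd2_pd1_kgOmega]
    exact div_ne_zero (neg_ne_zero.2 (mul_ne_zero (hne _ _ h1 (sin_sq_add_cos_sq _))
      (hne _ _ h2 (sin_sq_add_cos_sq _)))) (pow_ne_zero _ (kgOmega_pos p).ne')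

open scoped Manifold in
theorem exists_bound_of_forall_localDecay {f : ℝ × ℝ → ℝ} (hf : Continuous f)
    (hloc : ∀ p, LocalDecay f p) {a : ℝ × ℝ → ℝ} (ha : ContDiff ℝ ∞ a)
    (hac : HasCompactSupport a) :
    ∃ C : ℝ, ∀ v₁ v₂ t : ℝ, 1 ≤ t →
      ‖∫ z : ℝ × ℝ, Complex.exp (Complex.I *
        ((t * (v₁ * z.1 + v₂ * z.2 - f z) : ℝ) : ℂ)) * (a z : ℂ)‖ ≤ C * t ^ (-(3 : ℝ) / 4) := by
  choose U hUo hpU hU using hloc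
  obtain ⟨s, hs⟩ := hac.isCompact.elim_finite_subcover U hUo
    fun p _ => Set.mem_iUnion.2 ⟨p, hpU p⟩
  obtain ⟨ρ, hρ⟩ := SmoothPartitionOfUnity.exists_isSubordinate 𝓘(ℝ, ℝ × ℝ)
    (isClosed_tsupport a) (fun i : s => U i) (fun i => hUo i)
    (hs.trans fun z hz => by
      simp only [Set.mem_iUnion] at hz ⊢
      obtain ⟨i, hi, hz⟩ := hz
      exact ⟨⟨i, hi⟩, hz⟩)
  have hρs : ∀ i, ContDiff ℝ ∞ (ρ i) := fun i => (ρ i).contMDiff.contDiff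
  have hsum : ∀ z, a z = ∑ i, ρ i z * a z := by
    intro z
    rw [← Finset.sum_mul]
    by_cases hz : z ∈ tsupport a
    · rw [← finsum_eq_sum_of_fintype, ρ.sum_eq_one hz, one_mul]
    · rw [image_eq_zero_of_notMem_tsupport hz, mul_zero]
  have hb : ∀ i : s, ∃ C : ℝ, ∀ v₁ v₂ t : ℝ, 1 ≤ t →
      ‖∫ z : ℝ × ℝ, Complex.exp (Complex.I *
        ((t * (v₁ * z.1 + v₂ * z.2 - f z) : ℝ) : ℂ)) * ((ρ i z * a z : ℝ) : ℂ)‖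
          ≤ C * t ^ (-(3 : ℝ) / 4) := fun i =>
    hU i (fun z => ρ i z * a z) ((hρs i).mul ha) hac.mul_left
      ((tsupport_mul_subset_left).trans (hρ i))
  choose C hC using hb
  refine ⟨∑ i, C i, fun v₁ v₂ t ht => ?_⟩
  have hint : ∀ i : s, Integrable fun z : ℝ × ℝ => Complex.exp (Complex.I *
        ((t * (v₁ * z.1 + v₂ * z.2 - f z) : ℝ) : ℂ)) * ((ρ i z * a z : ℝ) : ℂ) := by
    intro i
    refine Continuous.integrable_of_hasCompactSupport ?_ ?_
    · have := (hρs i).continuous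
      have := ha.continuous
      fun_prop
    · refine HasCompactSupport.mul_left ?_
      exact (hac.mul_left (f := ρ i)).comp_left (g := fun x : ℝ => (x : ℂ)) Complex.ofReal_zero
  calc ‖∫ z : ℝ × ℝ, Complex.exp (Complex.I *
        ((t * (v₁ * z.1 + v₂ * z.2 - f z) : ℝ) : ℂ)) * (a z : ℂ)‖
      = ‖∑ i, ∫ z : ℝ × ℝ, Complex.exp (Complex.I *
        ((t * (v₁ * z.1 + v₂ * z.2 - f z) : ℝ) : ℂ)) * ((ρ i z * a z : ℝ) : ℂ)‖ := by
        rw [← integral_finsetSum _ fun i _ => hint i]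
        congr 2 with z
        rw [← Finset.mul_sum, ← Complex.ofReal_sum, ← hsum z]
    _ ≤ ∑ i, C i * t ^ (-(3 : ℝ) / 4) :=
        (norm_sum_le _ _).trans (Finset.sum_le_sum fun i _ => hC i v₁ v₂ t ht)
    _ = _ := (Finset.sum_mul ..).symm

/-- A smooth function supported in `[0, 2π + 1]` whose `2π`-translates sum to one. -/
def periodCutoff (x : ℝ) : ℝ := smoothTransition x - smoothTransition (x - 2 * π)

theorem contDiff_periodCutoff : ContDiff ℝ ∞ periodCutoff := by
  unfold periodCutoff
  exact smoothTransition.contDiff.sub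
    (smoothTransition.contDiff.comp (contDiff_id.sub contDiff_const))

theorem periodCutoff_eq_zero {x : ℝ} (hx : x ∉ Set.Icc 0 (2 * π + 1)) : periodCutoff x = 0 := by
  have hpi := pi_pos
  unfold periodCutoff
  rw [Set.mem_Icc, not_and_or, not_le, not_le] at hx
  rcases hx with hx | hx
  · rw [smoothTransition.zero_of_nonpos hx.le, smoothTransition.zero_of_nonpos (by linarith),
      sub_zero]
  · rw [smoothTransition.one_of_one_le (by linarith), smoothTransition.one_of_one_le (by linarith),
      sub_self]

theorem periodCutoff_add_periodCutoff {x : ℝ} (hx : x ∈ Set.Icc 0 (2 * π)) :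
    periodCutoff x + periodCutoff (x + 2 * π) = 1 := by
  have hpi := pi_gt_three
  have h1 : smoothTransition (x - 2 * π) = 0 := smoothTransition.zero_of_nonpos (by linarith [hx.2])
  have h2 : smoothTransition (x + 2 * π) = 1 := smoothTransition.one_of_one_le (by linarith [hx.1])
  have h3 : x + 2 * π - 2 * π = x := by ring
  unfold periodCutoff
  rw [h1, h2, h3]; ring

theorem integral_periodCutoff_mul {F : ℝ → ℂ} (hF : Continuous F)
    (hper : Function.Periodic F (2 * π)) :
    ∫ x, (periodCutoff x : ℂ) * F x = ∫ x in Set.Icc 0 (2 * π), F x := by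
  have hpi := pi_gt_three
  have hc : Continuous periodCutoff := contDiff_periodCutoff.continuous
  set G : ℝ → ℂ := fun x => (periodCutoff x : ℂ) * F x with hG
  have hGc : Continuous G := by fun_prop
  have h1 : ∫ x, G x = ∫ x in (0 : ℝ)..(2 * π + 2 * π), G x := by
    rw [intervalIntegral.integral_of_le (by linarith), ← integral_Icc_eq_integral_Ioc]
    refine (setIntegral_eq_integral_of_forall_compl_eq_zero fun x hx => ?_).symm
    have : x ∉ Set.Icc 0 (2 * π + 1) := fun h => hx ⟨h.1, by linarith [h.2]⟩
    simp [hG, periodCutoff_eq_zero this]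
  have h2 : ∫ x in (2 * π)..(2 * π + 2 * π), G x = ∫ x in (0 : ℝ)..(2 * π), G (x + 2 * π) := by
    rw [intervalIntegral.integral_comp_add_right, zero_add]
  rw [h1, ← intervalIntegral.integral_add_adjacent_intervals
      (hGc.intervalIntegrable 0 (2 * π)) (hGc.intervalIntegrable (2 * π) _), h2,
    ← intervalIntegral.integral_add (hGc.intervalIntegrable _ _)
      (Continuous.intervalIntegrable (u := fun x => G (x + 2 * π)) (by fun_prop) _ _),
    integral_Icc_eq_integral_Ioc, ← intervalIntegral.integral_of_le (by linarith)]
  refine intervalIntegral.integral_congr fun x hx => ?_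
  rw [Set.uIcc_of_le (by linarith)] at hx
  have h := congrArg (fun y : ℝ => (y : ℂ)) (periodCutoff_add_periodCutoff hx)
  simp only [Complex.ofReal_add, Complex.ofReal_one] at h
  simp only [hG, hper x]
  rw [← add_mul, h, one_mul]

theorem integral_periodCutoff_mul_prod {F : ℝ × ℝ → ℂ} (hF : Continuous F)
    (h₁ : ∀ x y, F (x + 2 * π, y) = F (x, y)) (h₂ : ∀ x y, F (x, y + 2 * π) = F (x, y)) :
    ∫ z : ℝ × ℝ, F z * ((periodCutoff z.1 * periodCutoff z.2 : ℝ) : ℂ) =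
      ∫ z in Set.Icc 0 (2 * π) ×ˢ Set.Icc 0 (2 * π), F z := by
  have hc : Continuous periodCutoff := contDiff_periodCutoff.continuous
  have hs : HasCompactSupport fun z : ℝ × ℝ =>
      F z * ((periodCutoff z.1 * periodCutoff z.2 : ℝ) : ℂ) := by
    refine HasCompactSupport.intro (isCompact_Icc.prod isCompact_Icc :
      IsCompact (Set.Icc 0 (2 * π + 1) ×ˢ Set.Icc 0 (2 * π + 1))) fun z hz => ?_
    rw [Set.mem_prod, not_and_or] at hz
    rcases hz with hz | hz <;> simp [periodCutoff_eq_zero hz]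
  have hi : Integrable fun z : ℝ × ℝ =>
      F z * ((periodCutoff z.1 * periodCutoff z.2 : ℝ) : ℂ) :=
    Continuous.integrable_of_hasCompactSupport (by fun_prop) hs
  rw [Measure.volume_eq_prod] at hi ⊢
  rw [integral_prod _ hi, setIntegral_prod _
    (hF.continuousOn.integrableOn_compact (isCompact_Icc.prod isCompact_Icc))]
  have hinner : ∀ x, ∫ y, F (x, y) * ((periodCutoff x * periodCutoff y : ℝ) : ℂ) =
      (periodCutoff x : ℂ) * ∫ y in Set.Icc 0 (2 * π), F (x, y) := by
    intro x
    rw [← integral_periodCutoff_mul (F := fun y => F (x, y)) (by fun_prop) (h₂ x),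
      ← integral_const_mul]
    congr 1 with y
    push_cast; ring
  simp_rw [hinner]
  refine integral_periodCutoff_mul ?_ fun x => by simp_rw [h₁]
  exact continuous_parametric_integral_of_continuous (by fun_prop) isCompact_Icc

theorem omegaKG_two (ξ : Fin 2 → ℝ) : omegaKG 2 ξ = kgOmega (ξ 0, ξ 1) := by
  simp only [omegaKG, kgOmega, kgSq, Fin.sum_univ_two]
  congr 1; ring

theorem oscInt_neg_neg {d : ℕ} {a : (Fin d → ℝ) → ℂ}
    (ha : ∀ ξ, (starRingEnd ℂ) (a ξ) = a ξ) (t : ℝ) (x : Fin d → ℤ) :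
    oscInt d a (-t) (-x) = (starRingEnd ℂ) (oscInt d a t x) := by
  unfold oscInt
  rw [← integral_conj]
  congr 1 with ξ
  rw [map_mul, ha, ← Complex.exp_conj, map_mul, Complex.conj_I, Complex.conj_ofReal]
  congr 2
  simp only [Pi.neg_apply, Int.cast_neg, neg_mul, Finset.sum_neg_distrib]
  push_cast; ring

theorem norm_oscInt_le (d : ℕ) (a : (Fin d → ℝ) → ℂ) (t : ℝ) (x : Fin d → ℤ) :
    ‖oscInt d a t x‖ ≤ ∫ ξ in cube d, ‖a ξ‖ := by
  refine (norm_integral_le_integral_norm _).trans_eq ?_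
  congr 1 with ξ
  rw [norm_mul, mul_comm Complex.I, Complex.norm_exp_ofReal_mul_I, one_mul]

theorem oscInt_two_eq (b : ℝ × ℝ → ℝ) (t : ℝ) (x : Fin 2 → ℤ) :
    oscInt 2 (fun ξ => (b (ξ 0, ξ 1) : ℂ)) t x =
      ∫ z in Set.Icc 0 (2 * π) ×ˢ Set.Icc 0 (2 * π), Complex.exp (Complex.I *
        (((x 0 : ℝ) * z.1 + (x 1 : ℝ) * z.2 - t * kgOmega z : ℝ) : ℂ)) * (b z : ℂ) := by
  rw [← (volume_preserving_finTwoArrow ℝ).setIntegral_preimage_emb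
    (MeasurableEquiv.measurableEmbedding _)]
  have hset : (MeasurableEquiv.finTwoArrow : (Fin 2 → ℝ) ≃ᵐ ℝ × ℝ) ⁻¹'
      (Set.Icc 0 (2 * π) ×ˢ Set.Icc 0 (2 * π)) = cube 2 := by
    ext ξ
    simp [cube, Pi.le_def, Fin.forall_fin_two, MeasurableEquiv.finTwoArrow]
  rw [hset, oscInt]
  simp [Fin.sum_univ_two, omegaKG_two, MeasurableEquiv.finTwoArrow]

theorem exp_I_mul_add_int_mul_two_pi (r : ℝ) (n : ℤ) :
    Complex.exp (Complex.I * ((r + n * (2 * π) : ℝ) : ℂ)) = Complex.exp (Complex.I * (r : ℂ)) := by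
  have : Complex.I * ((r + n * (2 * π) : ℝ) : ℂ) =
      Complex.I * (r : ℂ) + n * (2 * π * Complex.I) := by push_cast; ring
  rw [this, Complex.exp_add, Complex.exp_int_mul_two_pi_mul_I, mul_one]

theorem kgOmega_add_two_pi_fst (x y : ℝ) : kgOmega (x + 2 * π, y) = kgOmega (x, y) := by
  simp [kgOmega, kgSq]

theorem kgOmega_add_two_pi_snd (x y : ℝ) : kgOmega (x, y + 2 * π) = kgOmega (x, y) := by
  simp [kgOmega, kgSq]

theorem exists_norm_oscInt_two_le {b : ℝ × ℝ → ℝ} (hb : ContDiff ℝ ∞ b)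
    (h₁ : ∀ x y, b (x + 2 * π, y) = b (x, y)) (h₂ : ∀ x y, b (x, y + 2 * π) = b (x, y)) :
    ∃ C : ℝ, ∀ t : ℝ, 1 ≤ t → ∀ x : Fin 2 → ℤ,
      ‖oscInt 2 (fun ξ => (b (ξ 0, ξ 1) : ℂ)) t x‖ ≤ C * t ^ (-(3 : ℝ) / 4) := by
  set w : ℝ × ℝ → ℝ := fun z => b z * (periodCutoff z.1 * periodCutoff z.2) with hw
  have hws : ContDiff ℝ ∞ w := hb.mul
    ((contDiff_periodCutoff.comp contDiff_fst).mul (contDiff_periodCutoff.comp contDiff_snd))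
  have hwc : HasCompactSupport w := by
    refine HasCompactSupport.intro (isCompact_Icc.prod isCompact_Icc :
      IsCompact (Set.Icc 0 (2 * π + 1) ×ˢ Set.Icc 0 (2 * π + 1))) fun z hz => ?_
    rw [Set.mem_prod, not_and_or] at hz
    rcases hz with hz | hz <;> simp [hw, periodCutoff_eq_zero hz]
  obtain ⟨C, hC⟩ := exists_bound_of_forall_localDecay contDiff_kgOmega.continuous
    localDecay_kgOmega hws hwc
  refine ⟨C, fun t ht x => ?_⟩
  have ht0 : t ≠ 0 := by positivity
  have hω := contDiff_kgOmega.continuous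
  have hbc := hb.continuous
  rw [oscInt_two_eq, ← integral_periodCutoff_mul_prod (by fun_prop)]
  · refine le_of_eq_of_le ?_ (hC (x 0 / t) (x 1 / t) t ht)
    congr 2 with z
    rw [mul_assoc, ← Complex.ofReal_mul]
    congr 4
    field_simp
  · intro u v
    rw [h₁, kgOmega_add_two_pi_fst, ← exp_I_mul_add_int_mul_two_pi
      (x 0 * u + x 1 * v - t * kgOmega (u, v)) (x 0)]
    congr 4; ring
  · intro u v
    rw [h₂, kgOmega_add_two_pi_snd, ← exp_I_mul_add_int_mul_two_pi
      (x 0 * u + x 1 * v - t * kgOmega (u, v)) (x 1)]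
    congr 4; ring

theorem exists_norm_oscInt_two_le_one_add_abs {b : ℝ × ℝ → ℝ} (hb : ContDiff ℝ ∞ b)
    (h₁ : ∀ x y, b (x + 2 * π, y) = b (x, y)) (h₂ : ∀ x y, b (x, y + 2 * π) = b (x, y)) :
    ∃ C > 0, ∀ (t : ℝ) (x : Fin 2 → ℤ),
      ‖oscInt 2 (fun ξ => (b (ξ 0, ξ 1) : ℂ)) t x‖ ≤ C * (1 + |t|) ^ (-(3 : ℝ) / 4) := by
  obtain ⟨C, hC⟩ := exists_norm_oscInt_two_le hb h₁ h₂
  set a : (Fin 2 → ℝ) → ℂ := fun ξ => (b (ξ 0, ξ 1) : ℂ) with ha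
  set M : ℝ := max (max C (∫ ξ in cube 2, ‖a ξ‖)) 1 with hM
  have hM0 : 0 < M := lt_max_of_lt_right one_pos
  have hpos : ∀ t : ℝ, 0 ≤ t → ∀ x : Fin 2 → ℤ,
      ‖oscInt 2 a t x‖ ≤ M * 2 ^ ((3 : ℝ) / 4) * (1 + t) ^ (-(3 : ℝ) / 4) := by
    intro t ht x
    have hscale : ((1 + t) / 2) ^ (-(3 : ℝ) / 4) =
        2 ^ ((3 : ℝ) / 4) * (1 + t) ^ (-(3 : ℝ) / 4) := by
      rw [div_rpow (by positivity) (by positivity), neg_div,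
        rpow_neg (x := (2 : ℝ)) (by positivity), div_inv_eq_mul, mul_comm]
    rw [mul_assoc, ← hscale]
    rcases le_total 1 t with h1 | h1
    · calc ‖oscInt 2 a t x‖ ≤ C * t ^ (-(3 : ℝ) / 4) := hC t h1 x
        _ ≤ M * t ^ (-(3 : ℝ) / 4) := by
          gcongr
          exact (le_max_left _ _).trans (le_max_left _ _)
        _ ≤ M * ((1 + t) / 2) ^ (-(3 : ℝ) / 4) :=
          mul_le_mul_of_nonneg_left
            (rpow_le_rpow_of_nonpos (by positivity) (by linarith) (by norm_num)) hM0.le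
    · calc ‖oscInt 2 a t x‖ ≤ M * 1 := by
            rw [mul_one]
            exact (norm_oscInt_le _ _ _ _).trans ((le_max_right _ _).trans (le_max_left _ _))
        _ ≤ M * ((1 + t) / 2) ^ (-(3 : ℝ) / 4) := by
          gcongr
          exact one_le_rpow_of_pos_of_le_one_of_nonpos (by positivity) (by linarith) (by norm_num)
  refine ⟨M * 2 ^ ((3 : ℝ) / 4), by positivity, fun t x => ?_⟩
  rcases le_total 0 t with h | h
  · rw [abs_of_nonneg h]; exact hpos t h x
  · rw [abs_of_nonpos h]
    have := hpos (-t) (neg_nonneg.2 h) (-x)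
    rwa [oscInt_neg_neg fun ξ => Complex.conj_ofReal _, RCLike.norm_conj] at this

/-- Sharp dispersive decay for the discrete Klein--Gordon equation in dimension `d = 2`:
the `ℓ^∞` norm of the oscillatory integral decays like `(1+|t|)^{-3/4}`. -/
theorem dispersive_decay_d2
    (a : (Fin 2 → ℝ) → ℂ)
    (ha : a = (fun _ => 1) ∨ a = fun ξ => ((omegaKG 2 ξ : ℝ) : ℂ)⁻¹) :
    ∃ C > 0, ∀ (t : ℝ) (x : Fin 2 → ℤ),
      ‖oscInt 2 a t x‖ ≤ C * (1 + |t|) ^ (-(3 : ℝ)/4) := by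
  rcases ha with rfl | rfl
  · simpa using exists_norm_oscInt_two_le_one_add_abs (b := fun _ => 1) contDiff_const
      (fun _ _ => rfl) fun _ _ => rfl
  · have h := exists_norm_oscInt_two_le_one_add_abs (b := fun z => (kgOmega z)⁻¹)
      (contDiff_kgOmega.inv fun z => (kgOmega_pos z).ne')
      (fun x y => by rw [kgOmega_add_two_pi_fst]) fun x y => by rw [kgOmega_add_two_pi_snd]
    simpa only [omegaKG_two, Complex.ofReal_inv] using h
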